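/- arXiv:2403.03969 — 2 statements merged into one kernel-verified Lean document; each statement's English description precedes it below -/
import Mathlib

section
/- There exists a universal constant C > 0 with the following property. Let M = A₁ ∪ ⋯ ∪ Aₙ ⊆ ℝ^N be a union of n ≥ 2 affine subspaces of ℝ^N, each of dimension at most d ≥ 1, and let ε ∈ (0,1). Then there exist a natural number m with m ≤ C·ε^{-2}·(d + log n) and a map f : ℝ^N → ℝ^m such that (1−ε)‖x−y‖₂ ≤ ‖f(x)−f(y)‖₂ ≤ (1+ε)‖x−y‖₂ for all x ∈ M and all y ∈ ℝ^N. -/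
open MeasureTheory ProbabilityTheory
open scoped RealInnerProductSpace

/-- `A` is an affine subspace of dimension at most `d`. -/
def IsAffineOfDimLE {N : ℕ} (d : ℕ) (A : Set (EuclideanSpace ℝ (Fin N))) : Prop :=
  ∃ (v : EuclideanSpace ℝ (Fin N)) (W : Submodule ℝ (EuclideanSpace ℝ (Fin N))),
    Module.finrank ℝ W ≤ d ∧ A = (fun w => v + w) '' (W : Set (EuclideanSpace ℝ (Fin N)))

lemma one_le_one_sub_mul_exp {a : ℝ} (ha : |a| ≤ 1 / 2) :
    1 ≤ (1 - a) * Real.exp (a + a ^ 2) := by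
  obtain ⟨h1, h2⟩ := abs_le.1 ha
  rcases le_total a 0 with h | h
  · have := Real.add_one_le_exp (a + a ^ 2)
    nlinarith [pow_nonneg (neg_nonneg.2 h) 3]
  · have := Real.quadratic_le_exp_of_nonneg (x := a + a ^ 2) (by positivity)
    have h3 : (1 - a) * (1 + (a + a ^ 2) + (a + a ^ 2) ^ 2 / 2) ≤
      (1 - a) * Real.exp (a + a ^ 2) := by gcongr; linarith
    have h4 : 0 ≤ a ^ 2 * ((1 - a) * (1 + a) ^ 2 / 2 - a) := by
      have : a ≤ (1 - a) * (1 + a) ^ 2 / 2 := by nlinarith [sq_nonneg (1 - a)]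
      have := sub_nonneg.2 this
      positivity
    nlinarith

lemma integral_exp_mul_sq_gaussianReal {s : ℝ} (hs : s < 1 / 2) :
    ∫ x, Real.exp (s * x ^ 2) ∂(gaussianReal 0 1) = (√(1 - 2 * s))⁻¹ := by
  rw [integral_gaussianReal_eq_integral_smul one_ne_zero]
  have : ∀ x : ℝ, gaussianPDFReal 0 1 x • Real.exp (s * x ^ 2) =
      (√(2 * Real.pi))⁻¹ * Real.exp (-(1 / 2 - s) * x ^ 2) := by
    intro x
    simp only [gaussianPDFReal, smul_eq_mul, mul_assoc, ← Real.exp_add]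
    norm_num
    ring_nf
    simp
  simp_rw [this]
  rw [integral_const_mul, integral_gaussian, ← Real.sqrt_inv, ← Real.sqrt_mul (by positivity),
    ← Real.sqrt_inv]
  congr 1
  have : 1 - 2 * s ≠ 0 := by linarith
  have : 1 / 2 - s ≠ 0 := by linarith
  field_simp

lemma integrable_exp_mul_sq_gaussianReal {s : ℝ} (hs : s < 1 / 2) :
    Integrable (fun x : ℝ => Real.exp (s * x ^ 2)) (gaussianReal 0 1) := by
  by_contra h
  have h1 := integral_exp_mul_sq_gaussianReal hs
  rw [integral_undef h] at h1
  have : 0 < (√(1 - 2 * s))⁻¹ := inv_pos.2 (Real.sqrt_pos.2 (by linarith))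
  linarith

lemma integral_exp_mul_sq_sub_gaussianReal_le {s : ℝ} (hs : |s| ≤ 1 / 4) :
    ∫ x, Real.exp (s * (x ^ 2 - 1)) ∂(gaussianReal 0 1) ≤ Real.exp (2 * s ^ 2) := by
  have h1 : s < 1 / 2 := by linarith [le_abs_self s]
  have h2 : ∀ x : ℝ, Real.exp (s * (x ^ 2 - 1)) = Real.exp (-s) * Real.exp (s * x ^ 2) := by
    intro x; rw [← Real.exp_add]; ring_nf
  simp_rw [h2]
  rw [integral_const_mul, integral_exp_mul_sq_gaussianReal h1]
  have h3 : 0 < 1 - 2 * s := by linarith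
  rw [← div_eq_mul_inv, div_le_iff₀ (Real.sqrt_pos.2 h3)]
  have h4 := one_le_one_sub_mul_exp (a := 2 * s) (by rw [abs_mul]; norm_num; linarith)
  have h5 : Real.exp (2 * s + (2 * s) ^ 2) = (Real.exp (2 * s ^ 2) / Real.exp (-s)) ^ 2 := by
    rw [← Real.exp_sub, ← Real.exp_nat_mul]; push_cast; ring_nf
  rw [h5, ← Real.sq_sqrt h3.le, ← mul_pow] at h4
  have h6 := (one_le_sq_iff₀ (by positivity)).1 h4
  rw [mul_div_assoc', le_div_iff₀ (Real.exp_pos _)] at h6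
  linarith

lemma map_inner_stdGaussian {N : ℕ} {x : EuclideanSpace ℝ (Fin N)} (hx : ‖x‖ = 1) :
    (stdGaussian (EuclideanSpace ℝ (Fin N))).map (fun g => ⟪g, x⟫) = gaussianReal 0 1 := by
  have h := IsGaussian.map_eq_gaussianReal (μ := stdGaussian (EuclideanSpace ℝ (Fin N)))
    (innerSL ℝ x)
  rw [integral_strongDual_stdGaussian, variance_dual_stdGaussian, innerSL_apply_norm, hx] at h
  norm_num at h
  simp only [← h, real_inner_comm]

lemma integral_exp_inner_stdGaussian_le {N : ℕ} {x : EuclideanSpace ℝ (Fin N)} (hx : ‖x‖ = 1)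
    {s : ℝ} (hs : |s| ≤ 1 / 4) :
    ∫ g, Real.exp (s * (⟪g, x⟫ ^ 2 - 1)) ∂(stdGaussian (EuclideanSpace ℝ (Fin N))) ≤
      Real.exp (2 * s ^ 2) := by
  have := integral_exp_mul_sq_sub_gaussianReal_le hs
  rwa [← map_inner_stdGaussian hx, integral_map (by fun_prop) (by fun_prop)] at this

lemma integrable_exp_inner_stdGaussian {N : ℕ} {x : EuclideanSpace ℝ (Fin N)} (hx : ‖x‖ = 1)
    {s : ℝ} (hs : |s| ≤ 1 / 4) :
    Integrable (fun g => Real.exp (s * (⟪g, x⟫ ^ 2 - 1)))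
      (stdGaussian (EuclideanSpace ℝ (Fin N))) := by
  have h1 : s < 1 / 2 := by linarith [le_abs_self s]
  have h2 := (integrable_exp_mul_sq_gaussianReal h1).const_mul (Real.exp (-s))
  rw [← map_inner_stdGaussian hx, integrable_map_measure (by fun_prop) (by fun_prop)] at h2
  refine h2.congr (Filter.Eventually.of_forall fun g => ?_)
  simp only [Function.comp, ← Real.exp_add]
  ring_nf

/-- Chernoff bound: the moment generating function of `∑ j, (⟪G j, x⟫ ^ 2 - 1)` for independent
standard Gaussian vectors `G j`. -/
lemma integral_exp_sum_inner_le {N m : ℕ} {x : EuclideanSpace ℝ (Fin N)} (hx : ‖x‖ = 1)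
    {s : ℝ} (hs : |s| ≤ 1 / 4) :
    Integrable (fun G : Fin m → EuclideanSpace ℝ (Fin N) =>
        Real.exp (s * (∑ j, ⟪G j, x⟫ ^ 2 - m)))
      (Measure.pi fun _ => stdGaussian (EuclideanSpace ℝ (Fin N))) ∧
    ∫ G : Fin m → EuclideanSpace ℝ (Fin N), Real.exp (s * (∑ j, ⟪G j, x⟫ ^ 2 - m))
      ∂(Measure.pi fun _ => stdGaussian (EuclideanSpace ℝ (Fin N))) ≤
      Real.exp (2 * s ^ 2 * m) := by
  have h : ∀ G : Fin m → EuclideanSpace ℝ (Fin N),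
      Real.exp (s * (∑ j, ⟪G j, x⟫ ^ 2 - m)) = ∏ j, Real.exp (s * (⟪G j, x⟫ ^ 2 - 1)) := by
    intro G
    rw [← Real.exp_sum, ← Finset.mul_sum, Finset.sum_sub_distrib]
    simp
  simp_rw [h]
  refine ⟨Integrable.fintype_prod fun _ => integrable_exp_inner_stdGaussian hx hs, ?_⟩
  rw [integral_fintype_prod_eq_pow (fun g => Real.exp (s * (⟪g, x⟫ ^ 2 - 1))), Fintype.card_fin,
    mul_comm _ (m : ℝ), Real.exp_nat_mul]
  exact pow_le_pow_left₀ (integral_nonneg fun _ => (Real.exp_pos _).le)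
    (integral_exp_inner_stdGaussian_le hx hs) _

lemma exists_gaussian_of_sum_lt_one {N m : ℕ} {ι : Type*} [Fintype ι]
    (x : ι → EuclideanSpace ℝ (Fin N)) (hx : ∀ i, ‖x i‖ = 1) (δ : ι → ℝ)
    (hδ : ∀ i, 0 < δ i ∧ δ i ≤ 1) (hsum : ∑ i, 2 * Real.exp (-(m * δ i ^ 2 / 8)) < 1) :
    ∃ G : Fin m → EuclideanSpace ℝ (Fin N), ∀ i, |∑ j, ⟪G j, x i⟫ ^ 2 - m| ≤ δ i * m := by
  set μ : Measure (Fin m → EuclideanSpace ℝ (Fin N)) :=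
    Measure.pi fun _ => stdGaussian (EuclideanSpace ℝ (Fin N))
  let φ : ι → ℝ → (Fin m → EuclideanSpace ℝ (Fin N)) → ℝ := fun i s G =>
    Real.exp (-(m * δ i ^ 2 / 4)) * Real.exp (s * (∑ j, ⟪G j, x i⟫ ^ 2 - m))
  have hφ : ∀ i s, |s| = δ i / 4 → Integrable (φ i s) μ ∧
      ∫ G, φ i s G ∂μ ≤ Real.exp (-(m * δ i ^ 2 / 8)) := by
    intro i s hs
    obtain ⟨h1, h2⟩ := integral_exp_sum_inner_le (m := m) (hx i) (s := s)
      (by rw [hs]; linarith [(hδ i).2])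
    refine ⟨h1.const_mul _, ?_⟩
    simp only [φ]
    rw [integral_const_mul]
    calc _ ≤ Real.exp (-(m * δ i ^ 2 / 4)) * Real.exp (2 * s ^ 2 * m) := by gcongr
      _ = _ := by
        rw [← Real.exp_add, ← sq_abs s, hs]; ring_nf
  have hp : ∀ i, |δ i / 4| = δ i / 4 := fun i => abs_of_pos (by linarith [(hδ i).1])
  have hn : ∀ i, |-(δ i / 4)| = δ i / 4 := fun i => by rw [abs_neg, hp]
  have hφint : ∀ i ∈ Finset.univ, Integrable (fun G => φ i (δ i / 4) G + φ i (-(δ i / 4)) G) μ :=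
    fun i _ => (hφ i _ (hp i)).1.add (hφ i _ (hn i)).1
  obtain ⟨G, hG⟩ := exists_le_integral (integrable_finsetSum _ hφint)
  refine ⟨G, fun i => ?_⟩
  rw [integral_finsetSum _ hφint] at hG
  have h1 : ∑ i, ∫ G, (φ i (δ i / 4) G + φ i (-(δ i / 4)) G) ∂μ < 1 := by
    refine lt_of_le_of_lt (Finset.sum_le_sum fun i _ => ?_) hsum
    rw [integral_add (hφ i _ (hp i)).1 (hφ i _ (hn i)).1]
    linarith [(hφ i _ (hp i)).2, (hφ i _ (hn i)).2]
  have hpos : ∀ i s, 0 < φ i s G := fun i s => by positivity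
  have h2 := Finset.single_le_sum (f := fun i => φ i (δ i / 4) G + φ i (-(δ i / 4)) G)
    (fun i _ => (add_pos (hpos i _) (hpos i _)).le) (Finset.mem_univ i)
  have h3 : ∀ s, φ i s G < 1 → s * (∑ j, ⟪G j, x i⟫ ^ 2 - m) < m * δ i ^ 2 / 4 := by
    intro s hs
    simp only [φ] at hs
    rw [← Real.exp_add, Real.exp_lt_one_iff] at hs
    linarith
  have h4 := h3 (δ i / 4) (by linarith [hpos i (-(δ i / 4))])
  have h5 := h3 (-(δ i / 4)) (by linarith [hpos i (δ i / 4)])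
  have h6 := (hδ i).1
  rw [abs_le]
  constructor
  · by_contra! h
    nlinarith
  · by_contra! h
    nlinarith

/-- Johnson-Lindenstrauss lemma with a prescribed distortion for each vector. -/
lemma exists_linearMap_of_sum_lt_one {N m : ℕ} (hm : 0 < m) {ι : Type*} [Fintype ι]
    (x : ι → EuclideanSpace ℝ (Fin N)) (δ : ι → ℝ) (hδ : ∀ i, 0 < δ i ∧ δ i ≤ 1)
    (hsum : ∑ i, 2 * Real.exp (-(m * δ i ^ 2 / 8)) < 1) :
    ∃ P : EuclideanSpace ℝ (Fin N) →ₗ[ℝ] EuclideanSpace ℝ (Fin m),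
      ∀ i, |‖P (x i)‖ ^ 2 - ‖x i‖ ^ 2| ≤ δ i * ‖x i‖ ^ 2 := by
  classical
  obtain ⟨G, hG⟩ := exists_gaussian_of_sum_lt_one (m := m) (ι := {i // x i ≠ 0})
    (fun i => (‖x i‖⁻¹ : ℝ) • x i) (fun i => norm_smul_inv_norm i.2) (fun i => δ i)
    (fun i => hδ i) (by
      refine lt_of_le_of_lt ?_ hsum
      rw [← Finset.sum_subtype (Finset.univ.filter fun i => x i ≠ 0) (by simp)
        (fun i => 2 * Real.exp (-(m * δ i ^ 2 / 8)))]
      exact Finset.sum_le_sum_of_subset_of_nonneg (Finset.filter_subset _ _)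
        fun _ _ _ => by positivity)
  let P : EuclideanSpace ℝ (Fin N) →ₗ[ℝ] EuclideanSpace ℝ (Fin m) :=
    { toFun := fun v => WithLp.toLp 2 fun j => (√m)⁻¹ * ⟪G j, v⟫
      map_add' := fun v w => by ext j; simp [inner_add_right, mul_add]
      map_smul' := fun c v => by ext j; simp [inner_smul_right]; ring }
  have hm' : (0 : ℝ) < m := by exact_mod_cast hm
  have hP : ∀ v, ‖P v‖ ^ 2 = (m : ℝ)⁻¹ * ∑ j, ⟪G j, v⟫ ^ 2 := by
    intro v
    rw [EuclideanSpace.norm_sq_eq, Finset.mul_sum]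
    refine Finset.sum_congr rfl fun j _ => ?_
    simp [P, mul_pow]
  refine ⟨P, fun i => ?_⟩
  by_cases hi : x i = 0
  · simp [hi]
  have h := hG ⟨i, hi⟩
  have hn : 0 < ‖x i‖ := norm_pos_iff.2 hi
  simp only [inner_smul_right, mul_pow, ← Finset.mul_sum] at h
  have h2 : ‖P (x i)‖ ^ 2 - ‖x i‖ ^ 2 =
      (‖x i‖ ^ 2 / m) * ((‖x i‖⁻¹) ^ 2 * ∑ j, ⟪G j, x i⟫ ^ 2 - m) := by
    rw [hP]; field_simp
  rw [h2, abs_mul, abs_of_pos (by positivity)]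
  calc _ ≤ (‖x i‖ ^ 2 / m) * (δ i * m) := by gcongr
    _ = _ := by field_simp

lemma card_le_nine_pow_of_separated {E : Type*} [NormedAddCommGroup E] [NormedSpace ℝ E]
    [FiniteDimensional ℝ E] (s : Finset E) (hs : ∀ c ∈ s, ‖c‖ = 1)
    (h : ∀ c ∈ s, ∀ d ∈ s, c ≠ d → 1 / 4 ≤ ‖c - d‖) : s.card ≤ 9 ^ Module.finrank ℝ E := by
  borelize E
  let μ : Measure E := Measure.addHaar
  set A := ⋃ c ∈ s, Metric.ball (c : E) (1 / 8) with hA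
  have D : Set.Pairwise (s : Set E) (Function.onFun Disjoint fun c => Metric.ball c (1 / 8)) := by
    rintro c hc d hd hcd
    apply Metric.ball_disjoint_ball
    rw [dist_eq_norm]
    linarith [h c hc d hd hcd]
  have A_subset : A ⊆ Metric.ball (0 : E) (9 / 8) := by
    refine Set.iUnion₂_subset fun x hx => Metric.ball_subset_ball' ?_
    rw [dist_zero_right, hs x hx]
    norm_num
  have I : (s.card : ENNReal) * ENNReal.ofReal ((1 / 8) ^ Module.finrank ℝ E) *
      μ (Metric.ball 0 1) ≤
      ENNReal.ofReal ((9 / 8) ^ Module.finrank ℝ E) * μ (Metric.ball 0 1) :=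
    calc
      _ = μ A := by
        rw [hA, measure_biUnion_finset D fun c _ => measurableSet_ball]
        simp only [μ.addHaar_ball_of_pos _ (show (0 : ℝ) < 1 / 8 by norm_num)]
        simp only [Finset.sum_const, nsmul_eq_mul, mul_assoc]
      _ ≤ μ (Metric.ball (0 : E) (9 / 8)) := measure_mono A_subset
      _ = _ := by simp only [μ.addHaar_ball_of_pos _ (show (0 : ℝ) < 9 / 8 by norm_num)]
  have J := (ENNReal.mul_le_mul_iff_left
    (Metric.measure_ball_pos _ _ zero_lt_one).ne' measure_ball_lt_top.ne).1 I
  have K : (s.card : ℝ) ≤ (9 : ℝ) ^ Module.finrank ℝ E := by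
    have := ENNReal.toReal_le_of_le_ofReal (by positivity) J
    simpa [div_eq_mul_inv, mul_pow] using this
  exact mod_cast K

/-- The unit sphere of a finite-dimensional space has a small `1 / 4`-net. -/
lemma exists_net_sphere (E : Type*) [NormedAddCommGroup E] [NormedSpace ℝ E]
    [FiniteDimensional ℝ E] :
    ∃ s : Finset E, s.card ≤ 9 ^ Module.finrank ℝ E ∧ (∀ t ∈ s, ‖t‖ = 1) ∧
      ∀ x : E, ‖x‖ = 1 → ∃ t ∈ s, ‖x - t‖ ≤ 1 / 4 := by
  classical
  let p : Finset E → Prop := fun s => (∀ c ∈ s, ‖c‖ = 1) ∧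
    ∀ c ∈ s, ∀ d ∈ s, c ≠ d → 1 / 4 ≤ ‖c - d‖
  let S : Set ℕ := {k | ∃ s, p s ∧ s.card = k}
  have hb : ∀ k ∈ S, k ≤ 9 ^ Module.finrank ℝ E := by
    rintro k ⟨s, hs, rfl⟩
    exact card_le_nine_pow_of_separated s hs.1 hs.2
  have hS : sSup S ∈ S := Nat.sSup_mem ⟨0, ∅, by simp [p], rfl⟩ ⟨_, hb⟩
  obtain ⟨s, hs, hc⟩ := hS
  refine ⟨s, card_le_nine_pow_of_separated s hs.1 hs.2, hs.1, fun x hx => ?_⟩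
  by_contra! hne
  have hxs : x ∉ s := fun hxs => by
    have := hne x hxs
    norm_num at this
  have h1 : p (insert x s) := by
    refine ⟨?_, ?_⟩
    · intro c hc
      rcases Finset.mem_insert.1 hc with rfl | hc
      exacts [hx, hs.1 c hc]
    · intro c hc d hd hcd
      rcases Finset.mem_insert.1 hc with rfl | hc' <;>
        rcases Finset.mem_insert.1 hd with rfl | hd'
      · exact absurd rfl hcd
      · exact (hne d hd').le
      · rw [norm_sub_rev]; exact (hne c hc').le
      · exact hs.2 c hc' d hd' hcd
  have h2 : (insert x s).card ≤ sSup S := le_csSup ⟨_, hb⟩ ⟨_, h1, rfl⟩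
  rw [Finset.card_insert_of_notMem hxs] at h2
  omega

lemma abs_le_of_net {E : Type*} [NormedAddCommGroup E] [NormedSpace ℝ E] (s : Finset E)
    (hs : ∀ x : E, ‖x‖ = 1 → ∃ t ∈ s, ‖x - t‖ ≤ 1 / 4) (ψ : E →L[ℝ] ℝ) {c : ℝ} (hc : 0 ≤ c)
    (h : ∀ t ∈ s, -c ≤ ψ t) (x : E) : |ψ x| ≤ 2 * c * ‖x‖ := by
  have h1 : ∀ x : E, ‖x‖ = 1 → -(c + ‖ψ‖ / 4) ≤ ψ x := by
    intro x hx
    obtain ⟨t, ht, hxt⟩ := hs x hx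
    have h2 := ψ.le_opNorm (x - t)
    have h3 : ‖ψ‖ * ‖x - t‖ ≤ ‖ψ‖ * (1 / 4) := by gcongr
    rw [map_sub, Real.norm_eq_abs] at h2
    linarith [neg_abs_le (ψ x - ψ t), h t ht]
  have h2 : ‖ψ‖ ≤ c + ‖ψ‖ / 4 := by
    refine ψ.opNorm_le_of_unit_norm (by positivity) fun x hx => ?_
    rw [Real.norm_eq_abs, abs_le]
    refine ⟨h1 x hx, ?_⟩
    have := h1 (-x) (by simpa using hx)
    rw [map_neg] at this
    linarith
  have h3 : ‖ψ‖ ≤ 2 * c := by linarith [norm_nonneg ψ]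
  exact (ψ.le_opNorm x).trans (by gcongr)

lemma abs_norm_sq_sub_le_of_net {E F : Type*} [NormedAddCommGroup E] [InnerProductSpace ℝ E]
    [FiniteDimensional ℝ E] [NormedAddCommGroup F] [InnerProductSpace ℝ F] (s : Finset E)
    (hs1 : ∀ t ∈ s, ‖t‖ = 1)
    (hs : ∀ x : E, ‖x‖ = 1 → ∃ t ∈ s, ‖x - t‖ ≤ 1 / 4) (P : E →ₗ[ℝ] F) {c : ℝ}
    (h : ∀ t ∈ s, |‖P t‖ ^ 2 - ‖t‖ ^ 2| ≤ c) (x : E) :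
    |‖P x‖ ^ 2 - ‖x‖ ^ 2| ≤ 3 * c * ‖x‖ ^ 2 := by
  let q : E → ℝ := fun x => ‖P x‖ ^ 2 - ‖x‖ ^ 2
  have hP : Continuous P := P.continuous_of_finiteDimensional
  have hq : Continuous fun x => |q x| := by fun_prop
  have hsmul : ∀ (r : ℝ) (x : E), q (r • x) = r ^ 2 * q x := by
    intro r x
    simp only [q, map_smul, norm_smul, mul_pow, Real.norm_eq_abs, sq_abs]
    ring
  by_cases hx : x = 0
  · simp [hx]
  have hxn : ‖x‖ ≠ 0 := norm_ne_zero_iff.2 hx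
  have hsph : ∀ y : E, y ≠ 0 → (‖y‖⁻¹ : ℝ) • y ∈ Metric.sphere (0 : E) 1 := fun y hy => by
    simpa using norm_smul_inv_norm (𝕜 := ℝ) hy
  obtain ⟨x₀, hx₀, hmax⟩ := (isCompact_sphere (0 : E) 1).exists_isMaxOn ⟨_, hsph x hx⟩
    hq.continuousOn
  have hb : ∀ y : E, |q y| ≤ |q x₀| * ‖y‖ ^ 2 := by
    intro y
    by_cases hy : y = 0
    · simp [hy, q]
    have h1 : |q ((‖y‖⁻¹ : ℝ) • y)| ≤ |q x₀| := hmax (hsph y hy)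
    have hyn : 0 < ‖y‖ := norm_pos_iff.2 hy
    rw [hsmul, abs_mul, abs_of_nonneg (by positivity), inv_pow, inv_mul_le_iff₀ (by positivity)]
      at h1
    linarith
  have hx₀' : ‖x₀‖ = 1 := by simpa using hx₀
  obtain ⟨t, ht, hxt⟩ := hs x₀ hx₀'
  have hpol : q x₀ - q t = (q ((2 : ℝ) • (x₀ - t) + (1 / 2 : ℝ) • (x₀ + t)) -
      q ((2 : ℝ) • (x₀ - t) - (1 / 2 : ℝ) • (x₀ + t))) / 4 := by
    simp only [q, map_add, map_sub, map_smul, ← real_inner_self_eq_norm_sq, inner_add_left,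
      inner_add_right, inner_sub_left, inner_sub_right, inner_smul_left, inner_smul_right]
    rw [real_inner_comm x₀ t, real_inner_comm (P x₀) (P t)]
    simp
    ring
  have h1 := hb ((2 : ℝ) • (x₀ - t) + (1 / 2 : ℝ) • (x₀ + t))
  have h2 := hb ((2 : ℝ) • (x₀ - t) - (1 / 2 : ℝ) • (x₀ + t))
  have h3 := parallelogram_law_with_norm ℝ ((2 : ℝ) • (x₀ - t)) ((1 / 2 : ℝ) • (x₀ + t))
  rw [norm_smul, norm_smul] at h3
  norm_num at h3
  have h4 : ‖x₀ + t‖ ≤ 2 := (norm_add_le _ _).trans (by rw [hx₀', hs1 t ht]; norm_num)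
  have h5 : ‖x₀ - t‖ ^ 2 ≤ 1 / 16 := by nlinarith [norm_nonneg (x₀ - t)]
  have h6 : ‖x₀ + t‖ ^ 2 ≤ 4 := by nlinarith [norm_nonneg (x₀ + t)]
  set U := ‖(2 : ℝ) • (x₀ - t) + (1 / 2 : ℝ) • (x₀ + t)‖
  set V := ‖(2 : ℝ) • (x₀ - t) - (1 / 2 : ℝ) • (x₀ + t)‖
  have h7 : U ^ 2 + V ^ 2 ≤ 5 / 2 := by
    norm_num [U, V] at h3 ⊢
    nlinarith
  have h8 : |q x₀| * U ^ 2 + |q x₀| * V ^ 2 ≤ |q x₀| * (5 / 2) := by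
    rw [← mul_add]; gcongr
  have h9 : |q x₀| ≤ |q t| + |q x₀ - q t| := by
    have := abs_add_le (q t) (q x₀ - q t)
    simpa using this
  have h10 := abs_sub (q ((2 : ℝ) • (x₀ - t) + (1 / 2 : ℝ) • (x₀ + t)))
    (q ((2 : ℝ) • (x₀ - t) - (1 / 2 : ℝ) • (x₀ + t)))
  rw [hpol, abs_div, abs_of_pos (show (0 : ℝ) < 4 by norm_num)] at h9
  have h11 : |q t| ≤ c := h t ht
  have h12 : |q x₀| ≤ 3 * c := by linarith [abs_nonneg (q x₀)]
  exact (hb x).trans (by gcongr)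

lemma le_of_forall_sum_le {E : Type*} [AddCommGroup E] [Module ℝ E] (B : E →ₗ[ℝ] E →ₗ[ℝ] ℝ)
    (hB : ∀ x y, B x y = B y x) (T : Finset E) (w : E → ℝ) (hw : ∀ t ∈ T, 0 ≤ w t)
    (hw1 : ∑ t ∈ T, w t = 1) {c : ℝ} (k : ℕ) : ∀ a : E,
    (∀ τ : Fin k → E, (∀ i, τ i ∈ T) → c ≤ B (a + ∑ i, τ i) (a + ∑ i, τ i)) →
    c ≤ B a a + 2 * k * B a (∑ t ∈ T, w t • t) + k * ∑ t ∈ T, w t * B t t +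
      k * (k - 1) * B (∑ t ∈ T, w t • t) (∑ t ∈ T, w t • t) := by
  set z := ∑ t ∈ T, w t • t with hz
  induction k with
  | zero => intro a h; simpa using h Fin.elim0 (fun i => i.elim0)
  | succ k ih =>
    intro a h
    have h1 : ∀ t ∈ T, c ≤ B (a + t) (a + t) + 2 * k * B (a + t) z +
        k * ∑ t ∈ T, w t * B t t + k * (k - 1) * B z z := by
      intro t ht
      refine ih (a + t) fun τ hτ => ?_
      have := h (Fin.cons t τ) (Fin.cases ht hτ)
      simpa [Fin.sum_univ_succ, add_assoc] using this
    have h2 := Finset.sum_le_sum fun t ht => mul_le_mul_of_nonneg_left (h1 t ht) (hw t ht)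
    rw [← Finset.sum_mul, hw1, one_mul] at h2
    have h3 : ∀ y, ∑ t ∈ T, w t * B y t = B y z := by
      intro y; simp [hz, map_sum]
    have h4 : ∑ t ∈ T, w t * B t z = B z z := by
      simp_rw [hB _ z, h3]
    refine h2.trans (le_of_eq ?_)
    have h5 : ∀ t, w t * (B (a + t) (a + t) + 2 * k * B (a + t) z +
        k * ∑ t ∈ T, w t * B t t + k * (k - 1) * B z z) =
        w t * (B a a + 2 * k * B a z + k * ∑ t ∈ T, w t * B t t + k * (k - 1) * B z z) +
        2 * (w t * B a t) + w t * B t t + 2 * k * (w t * B t z) := by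
      intro t
      simp only [map_add, LinearMap.add_apply]
      rw [hB t a]
      ring
    simp_rw [h5, Finset.sum_add_distrib, ← Finset.mul_sum, ← Finset.sum_mul, hw1, h3, h4]
    push_cast
    ring

/-- Maurey's empirical method, applied to the quadratic form `‖P x‖ ^ 2 - (1 - ε √k) ‖x‖ ^ 2`:
if `P` does not contract sums of `k` elements of `T` by much, for all `k`, then it does not
contract the convex hull of `T` by much. -/
lemma norm_sub_le_norm_map_of_convex {E F : Type*} [NormedAddCommGroup E] [InnerProductSpace ℝ E]
    [NormedAddCommGroup F] [InnerProductSpace ℝ F] (P : E →ₗ[ℝ] F) (T : Finset E)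
    (hT : ∀ t ∈ T, ‖t‖ = 1) {ε : ℝ} (hε : 0 < ε) (hup : ∀ t ∈ T, ‖P t‖ ^ 2 ≤ 1 + ε)
    (hlow : ∀ k : ℕ, ∀ τ : Fin k → E, (∀ i, τ i ∈ T) →
      (1 - ε * √k) * ‖∑ i, τ i‖ ^ 2 ≤ ‖P (∑ i, τ i)‖ ^ 2)
    (w : E → ℝ) (hw : ∀ t ∈ T, 0 ≤ w t) (hw1 : ∑ t ∈ T, w t = 1) :
    ‖∑ t ∈ T, w t • t‖ - 5 * ε ≤ ‖P (∑ t ∈ T, w t • t)‖ := by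
  set z := ∑ t ∈ T, w t • t with hz
  set r := ‖z‖ with hr
  rcases le_total r (5 * ε) with hrε | hrε
  · linarith [norm_nonneg (P z)]
  have hr0 : 0 < r := by linarith
  have hr1 : r ≤ 1 := by
    calc r ≤ ∑ t ∈ T, ‖w t • t‖ := norm_sum_le _ _
      _ = ∑ t ∈ T, w t := Finset.sum_congr rfl fun t ht => by
        rw [norm_smul, hT t ht, Real.norm_eq_abs, abs_of_nonneg (hw t ht), mul_one]
      _ = 1 := hw1
  set j := ⌈1 / r ^ 2⌉₊ with hj
  have hj1 : 1 / r ^ 2 ≤ j := Nat.le_ceil _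
  have hj2 : (j : ℝ) < 1 / r ^ 2 + 1 := Nat.ceil_lt_add_one (by positivity)
  have hjr : 1 ≤ 1 / r ^ 2 := by
    rw [le_div_iff₀ (by positivity)]; nlinarith
  have hj0 : (0 : ℝ) < j := by linarith
  set δ := ε * √((j + 1 : ℕ) : ℝ) with hδ
  have hδr : δ * r ≤ 2 * ε := by
    have : √((j + 1 : ℕ) : ℝ) ≤ 2 / r := by
      rw [Real.sqrt_le_left (by positivity), div_pow]
      push_cast
      have : 2 ^ 2 / r ^ 2 = 4 * (1 / r ^ 2) := by ring
      linarith
    calc δ * r ≤ ε * (2 / r) * r := by rw [hδ]; gcongr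
      _ = 2 * ε := by field_simp
  have hδ0 : 0 ≤ δ := by positivity
  let B : E →ₗ[ℝ] E →ₗ[ℝ] ℝ := (innerₗ F).compl₁₂ P P - (1 - δ) • innerₗ E
  have hBq : ∀ x, B x x = ‖P x‖ ^ 2 - (1 - δ) * ‖x‖ ^ 2 := by
    intro x
    simp [B]
  have hBs : ∀ x y, B x y = B y x := by
    intro x y
    simp [B, real_inner_comm]
  have key := le_of_forall_sum_le B hBs T w hw hw1 (c := 0) (j + 1) 0 (by
    intro τ hτ
    rw [zero_add, hBq]
    have := hlow (j + 1) τ hτ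
    linarith)
  rw [← hz] at key
  have hS : ∑ t ∈ T, w t * B t t ≤ ε + δ := by
    calc _ ≤ ∑ t ∈ T, w t * (ε + δ) := by
          refine Finset.sum_le_sum fun t ht => mul_le_mul_of_nonneg_left ?_ (hw t ht)
          rw [hBq, hT t ht]
          linarith [hup t ht]
      _ = ε + δ := by rw [← Finset.sum_mul, hw1, one_mul]
  simp only [map_zero, LinearMap.zero_apply, mul_zero, zero_add] at key
  push_cast at key
  have key2 : 0 ≤ (ε + δ) + j * B z z := by
    have h1 : 0 ≤ ((j : ℝ) + 1) * (∑ t ∈ T, w t * B t t + j * B z z) := by linarith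
    have := nonneg_of_mul_nonneg_right h1 (by positivity)
    linarith
  rw [hBq, ← hr] at key2
  have key3 : -(r ^ 2 * (ε + δ)) ≤ ‖P z‖ ^ 2 - (1 - δ) * r ^ 2 := by
    have h1 : 1 ≤ j * r ^ 2 := by
      rw [div_le_iff₀ (by positivity)] at hj1; exact hj1
    have h2 : 0 ≤ (ε + δ) * (j * r ^ 2 - 1) := mul_nonneg (by positivity) (by linarith)
    have h3 : 0 ≤ (j : ℝ) * (r ^ 2 * (ε + δ) + (‖P z‖ ^ 2 - (1 - δ) * r ^ 2)) := by linarith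
    have := nonneg_of_mul_nonneg_right h3 hj0
    linarith
  have h4 : r ^ 2 * (ε + δ) ≤ 3 * ε * r := by
    have : r * ε + δ * r ≤ 3 * ε := by nlinarith
    nlinarith [mul_le_mul_of_nonneg_left this hr0.le]
  have h5 : δ * r ^ 2 ≤ 2 * ε * r := by nlinarith
  refine abs_le_of_sq_le_sq' ?_ (norm_nonneg _) |>.2
  nlinarith

/-- Minimax duality: a lower bound for `P` on the convex hull of `T` lets one transfer each vector
`v` to the target without decreasing its inner products with `T` by much. -/
lemma exists_inner_map_ge {E F : Type*} [NormedAddCommGroup E] [InnerProductSpace ℝ E]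
    [NormedAddCommGroup F] [InnerProductSpace ℝ F] [FiniteDimensional ℝ F] (P : E →ₗ[ℝ] F)
    (T : Finset E) {η : ℝ} (h : ∀ w : E → ℝ, (∀ t ∈ T, 0 ≤ w t) → ∑ t ∈ T, w t = 1 →
      ‖∑ t ∈ T, w t • t‖ - η ≤ ‖P (∑ t ∈ T, w t • t)‖) (v : E) :
    ∃ u : F, ‖u‖ ≤ ‖v‖ ∧ ∀ t ∈ T, ⟪v, t⟫ - η * ‖v‖ ≤ ⟪u, P t⟫ := by
  classical
  have hhom : ∀ w : E → ℝ, (∀ t ∈ T, 0 ≤ w t) →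
      ‖∑ t ∈ T, w t • t‖ - η * ∑ t ∈ T, w t ≤ ‖P (∑ t ∈ T, w t • t)‖ := by
    intro w hw
    rcases (Finset.sum_nonneg hw).eq_or_lt with h0 | h0
    · have : ∀ t ∈ T, w t = 0 := (Finset.sum_eq_zero_iff_of_nonneg hw).1 h0.symm
      have h1 : ∑ t ∈ T, w t • t = 0 :=
        Finset.sum_eq_zero fun t ht => by rw [this t ht, zero_smul]
      rw [h1, ← h0]
      simp
    · set s := ∑ t ∈ T, w t
      have h1 := h (fun t => s⁻¹ * w t) (fun t ht => mul_nonneg (inv_nonneg.2 h0.le) (hw t ht))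
        (by rw [← Finset.mul_sum]; exact inv_mul_cancel₀ h0.ne')
      simp_rw [mul_smul, ← Finset.smul_sum, map_smul, norm_smul, Real.norm_eq_abs,
        abs_of_pos (inv_pos.2 h0)] at h1
      have h2 := mul_le_mul_of_nonneg_left h1 h0.le
      rw [mul_sub, mul_inv_cancel_left₀ h0.ne', mul_inv_cancel_left₀ h0.ne'] at h2
      linarith
  let Φ : F →ₗ[ℝ] (T → ℝ) := LinearMap.pi fun t => (innerₗ F).flip (P t)
  have hΦ : ∀ u t, Φ u t = ⟪u, P t⟫ := fun u t => by simp [Φ, real_inner_comm]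
  let b : T → ℝ := fun t => ⟪v, (t : E)⟫ - η * ‖v‖
  by_cases hd : Disjoint (Φ '' Metric.closedBall 0 ‖v‖) (Set.Ici b)
  · exfalso
    obtain ⟨f, α, β, h1, h2, h3⟩ := geometric_hahn_banach_compact_closed
      ((convex_closedBall (0 : F) ‖v‖).linear_image Φ)
      ((isCompact_closedBall (0 : F) ‖v‖).image Φ.continuous_of_finiteDimensional)
      (convex_Ici b) isClosed_Ici hd
    let l : T → ℝ := fun t => f (Pi.single t 1)
    have hf : ∀ a, f a = ∑ t, l t * a t := by
      intro a
      conv_lhs => rw [pi_eq_sum_univ' a]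
      simp [l, map_sum, mul_comm]
    have hl : ∀ t, 0 ≤ l t := by
      intro t
      by_contra! hlt
      have hr : 0 ≤ (β - f b) / l t := by
        have := h3 b (Set.mem_Ici.2 le_rfl)
        exact div_nonneg_of_nonpos (by linarith) hlt.le
      have := h3 (b + ((β - f b) / l t) • Pi.single t 1) (by
        rw [Set.mem_Ici]
        refine le_add_of_nonneg_right (smul_nonneg hr ?_)
        exact Pi.single_nonneg.2 zero_le_one)
      rw [map_add, map_smul, smul_eq_mul] at this
      change β < f b + (β - f b) / l t * l t at this
      rw [div_mul_cancel₀ _ hlt.ne] at this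
      linarith
    let w : E → ℝ := fun t => if ht : t ∈ T then l ⟨t, ht⟩ else 0
    have hw : ∀ t : T, w t = l t := fun t => by simp [w]
    set z := ∑ t ∈ T, w t • t with hz
    have h4 := hhom w (fun t ht => by rw [hw ⟨t, ht⟩]; exact hl _)
    rw [← hz] at h4
    have h5 : f b = ⟪v, z⟫ - η * (∑ t ∈ T, w t) * ‖v‖ := by
      rw [hf, hz, inner_sum, ← Finset.sum_coe_sort T, ← Finset.sum_coe_sort T, Finset.mul_sum,
        Finset.sum_mul, ← Finset.sum_sub_distrib]
      refine Finset.sum_congr rfl fun t _ => ?_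
      rw [hw, inner_smul_right]
      ring
    have h6 : ∀ u, f (Φ u) = ⟪u, P z⟫ := by
      intro u
      rw [hf, hz, map_sum, inner_sum, ← Finset.sum_coe_sort T]
      refine Finset.sum_congr rfl fun t _ => ?_
      rw [hw, map_smul, inner_smul_right, hΦ]
    set u := ‖v‖ • ((‖P z‖⁻¹ : ℝ) • P z) with hu
    have h7 : ‖u‖ ≤ ‖v‖ ∧ ⟪u, P z⟫ = ‖v‖ * ‖P z‖ := by
      by_cases hPz : P z = 0
      · simp [hu, hPz]
      · have hn : ‖P z‖ ≠ 0 := norm_ne_zero_iff.2 hPz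
        refine ⟨?_, ?_⟩
        · rw [hu, norm_smul, norm_smul, norm_inv, norm_norm, norm_norm, inv_mul_cancel₀ hn, mul_one]
        · rw [hu, inner_smul_left, inner_smul_left, real_inner_self_eq_norm_sq]
          simp only [conj_trivial]
          field_simp
    have h8 := h1 (Φ u) (Set.mem_image_of_mem _ (by simpa using h7.1))
    have h9 := h3 b (Set.mem_Ici.2 le_rfl)
    rw [h6, h7.2] at h8
    rw [h5] at h9
    have h10 := real_inner_le_norm v z
    nlinarith [mul_le_mul_of_nonneg_left h4 (norm_nonneg v)]
  · obtain ⟨_, ⟨u, hu, rfl⟩, hub⟩ := Set.not_disjoint_iff.1 hd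
    refine ⟨u, by simpa using hu, fun t ht => ?_⟩
    have := hub ⟨t, ht⟩
    rwa [hΦ] at this

lemma exists_closest {N n : ℕ} (hn : 0 < n) {d : ℕ} (A : Fin n → Set (EuclideanSpace ℝ (Fin N)))
    (hA : ∀ i, IsAffineOfDimLE d (A i)) (y : EuclideanSpace ℝ (Fin N)) :
    ∃ x ∈ ⋃ i, A i, ∀ x' ∈ ⋃ i, A i, ‖y - x‖ ≤ ‖y - x'‖ := by
  have hc : IsClosed (⋃ i, A i) := by
    refine isClosed_iUnion_of_finite fun i => ?_
    obtain ⟨v, W, -, h⟩ := hA i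
    rw [h]
    exact (Homeomorph.addLeft v).isClosedMap _ W.closed_of_finiteDimensional
  have hne : (⋃ i, A i).Nonempty := by
    obtain ⟨v, W, -, h⟩ := hA ⟨0, hn⟩
    exact ⟨v + 0, Set.mem_iUnion.2 ⟨⟨0, hn⟩, by rw [h]; exact ⟨0, W.zero_mem, rfl⟩⟩⟩
  obtain ⟨x, hx, h⟩ := hc.exists_infDist_eq_dist hne y
  refine ⟨x, hx, fun x' hx' => ?_⟩
  rw [← dist_eq_norm, ← dist_eq_norm, ← h]
  exact Metric.infDist_le_dist_of_mem hx'

lemma exists_submodule_sub_mem {N n d : ℕ} (A : Fin n → Set (EuclideanSpace ℝ (Fin N)))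
    (hA : ∀ i, IsAffineOfDimLE d (A i)) :
    ∃ L : Fin n × Fin n → Submodule ℝ (EuclideanSpace ℝ (Fin N)),
      (∀ p, Module.finrank ℝ (L p) ≤ 2 * d + 1) ∧
      ∀ x ∈ ⋃ i, A i, ∀ y ∈ ⋃ i, A i, ∃ p, x - y ∈ L p := by
  choose v W hW hAW using hA
  refine ⟨fun p => W p.1 ⊔ W p.2 ⊔ Submodule.span ℝ {v p.1 - v p.2}, fun p => ?_, ?_⟩
  · have h1 := Submodule.finrank_add_le_finrank_add_finrank (W p.1 ⊔ W p.2)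
      (Submodule.span ℝ {v p.1 - v p.2})
    have h2 := Submodule.finrank_add_le_finrank_add_finrank (W p.1) (W p.2)
    have h3 := finrank_span_le_card (R := ℝ) ({v p.1 - v p.2} : Set (EuclideanSpace ℝ (Fin N)))
    rw [Set.toFinset_singleton, Finset.card_singleton] at h3
    have := hW p.1
    have := hW p.2
    beta_reduce
    omega
  · intro x hx y hy
    obtain ⟨i, hi⟩ := Set.mem_iUnion.1 hx
    obtain ⟨j, hj⟩ := Set.mem_iUnion.1 hy
    rw [hAW] at hi hj
    obtain ⟨a, ha, rfl⟩ := hi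
    obtain ⟨b, hb, rfl⟩ := hj
    refine ⟨(i, j), ?_⟩
    have : v i + a - (v j + b) = (a - b) + (v i - v j) := by abel
    simp only [this]
    exact Submodule.add_mem_sup (Submodule.sub_mem _ (Submodule.mem_sup_left ha)
      (Submodule.mem_sup_right hb)) (Submodule.mem_span_singleton_self _)

lemma exists_linearMap_of_card_le {N m : ℕ} (hm : 0 < m) (T : Finset (EuclideanSpace ℝ (Fin N)))
    (hT : ∀ t ∈ T, ‖t‖ = 1) {K ε : ℝ} (hK : T.card ≤ K) (hε : 0 < ε) (hε1 : ε ≤ 1)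
    (hmK : K * Real.exp (-(m * ε ^ 2 / 8)) ≤ 1 / 4) :
    ∃ P : EuclideanSpace ℝ (Fin N) →ₗ[ℝ] EuclideanSpace ℝ (Fin m),
      (∀ t ∈ T, |‖P t‖ ^ 2 - ‖t‖ ^ 2| ≤ ε) ∧
      ∀ k : ℕ, ∀ τ : Fin k → EuclideanSpace ℝ (Fin N), (∀ i, τ i ∈ T) →
        (1 - ε * √k) * ‖∑ i, τ i‖ ^ 2 ≤ ‖P (∑ i, τ i)‖ ^ 2 := by
  classical
  set k₀ := ⌊(ε⁻¹) ^ 2⌋₊ with hk₀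
  have hk : ∀ k : ℕ, k + 1 ≤ k₀ ↔ ε * √((k + 1 : ℕ) : ℝ) ≤ 1 := by
    intro k
    rw [hk₀, Nat.le_floor_iff (by positivity), ← le_div_iff₀' hε, one_div,
      Real.sqrt_le_left (by positivity)]
  obtain ⟨P, hP⟩ := exists_linearMap_of_sum_lt_one (N := N) hm
    (ι := Σ k : Fin k₀, (Fin (k + 1) → T)) (fun i => ∑ j, (i.2 j : EuclideanSpace ℝ (Fin N)))
    (fun i => ε * √((i.1 + 1 : ℕ) : ℝ)) (fun i => ⟨by positivity, (hk i.1).1 i.1.2⟩) (by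
      have h1 : ∀ n : ℕ, ∑ k ∈ Finset.range n, 2 * (1 / 4 : ℝ) ^ (k + 1) ≤
          2 / 3 * (1 - (1 / 4) ^ n) := by
        intro n
        induction n with
        | zero => simp
        | succ n ih => rw [Finset.sum_range_succ, pow_succ]; linarith
      rw [Fintype.sum_sigma]
      refine lt_of_le_of_lt (b := ∑ k : Fin k₀, 2 * (1 / 4 : ℝ) ^ ((k : ℕ) + 1)) ?_ ?_
      · refine Finset.sum_le_sum fun k _ => ?_
        dsimp only
        rw [Finset.sum_const, Finset.card_univ, Fintype.card_fun, Fintype.card_coe,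
          Fintype.card_fin, nsmul_eq_mul]
        have h2 : Real.exp (-(m * (ε * √((k + 1 : ℕ) : ℝ)) ^ 2 / 8)) =
            Real.exp (-(m * ε ^ 2 / 8)) ^ ((k : ℕ) + 1) := by
          rw [← Real.exp_nat_mul, mul_pow, Real.sq_sqrt (by positivity)]
          ring_nf
        have h3 : (T.card * Real.exp (-(m * ε ^ 2 / 8))) ^ ((k : ℕ) + 1) ≤
            (1 / 4 : ℝ) ^ ((k : ℕ) + 1) := by
          refine pow_le_pow_left₀ (by positivity) (le_trans ?_ hmK) _
          gcongr
        simp only [h2]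
        rw [mul_pow] at h3
        push_cast
        linarith
      · rw [Fin.sum_univ_eq_sum_range (fun k => 2 * (1 / 4 : ℝ) ^ (k + 1))]
        have : (0 : ℝ) < (1 / 4) ^ k₀ := by positivity
        linarith [h1 k₀])
  have hP' : ∀ k : ℕ, k + 1 ≤ k₀ → ∀ τ : Fin (k + 1) → EuclideanSpace ℝ (Fin N),
      (∀ i, τ i ∈ T) → |‖P (∑ i, τ i)‖ ^ 2 - ‖∑ i, τ i‖ ^ 2| ≤
        ε * √((k + 1 : ℕ) : ℝ) * ‖∑ i, τ i‖ ^ 2 :=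
    fun k hk τ hτ => hP ⟨⟨k, hk⟩, fun i => ⟨τ i, hτ i⟩⟩
  refine ⟨P, fun t ht => ?_, fun k τ hτ => ?_⟩
  · have := hP' 0 ((hk 0).2 (by simpa using hε1)) (fun _ => t) (fun _ => ht)
    simpa [hT t ht] using this
  · cases k with
    | zero => simp
    | succ k =>
      by_cases hkk : k + 1 ≤ k₀
      · have := (abs_le.1 (hP' k hkk τ hτ)).1
        linarith
      · rw [hk, not_le] at hkk
        exact (mul_nonpos_of_nonpos_of_nonneg (by linarith) (by positivity)).trans
          (by positivity)

/-- A random projection to dimension `m` that nearly preserves norms on a family of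
low-dimensional subspaces `L p`, and admits outer extensions for all of them. -/
lemma exists_linearMap_submodules {N m D : ℕ} (hm : 0 < m) {ι : Type*} [Fintype ι]
    (L : ι → Submodule ℝ (EuclideanSpace ℝ (Fin N))) (hL : ∀ p, Module.finrank ℝ (L p) ≤ D)
    {ε : ℝ} (hε : 0 < ε) (hε1 : ε ≤ 1)
    (hmK : (Fintype.card ι * 9 ^ D : ℝ) * Real.exp (-(m * ε ^ 2 / 8)) ≤ 1 / 4) :
    ∃ P : EuclideanSpace ℝ (Fin N) →ₗ[ℝ] EuclideanSpace ℝ (Fin m),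
      (∀ p, ∀ x ∈ L p, |‖P x‖ ^ 2 - ‖x‖ ^ 2| ≤ 3 * ε * ‖x‖ ^ 2) ∧
      ∀ v, ∃ u, ‖u‖ ≤ ‖v‖ ∧ ∀ p, ∀ x ∈ L p, |⟪u, P x⟫ - ⟪v, x⟫| ≤ 10 * ε * ‖v‖ * ‖x‖ := by
  classical
  choose s hs hs1 hsnet using fun p => exists_net_sphere (L p)
  let T : Finset (EuclideanSpace ℝ (Fin N)) :=
    Finset.univ.biUnion fun p => (s p).image Subtype.val
  have hmem : ∀ p, ∀ t ∈ s p, (t : EuclideanSpace ℝ (Fin N)) ∈ T := fun p t ht =>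
    Finset.mem_biUnion.2 ⟨p, Finset.mem_univ _, Finset.mem_image_of_mem _ ht⟩
  have hT : ∀ t ∈ T, ‖t‖ = 1 := by
    intro t ht
    obtain ⟨p, -, ht⟩ := Finset.mem_biUnion.1 ht
    obtain ⟨t, ht', rfl⟩ := Finset.mem_image.1 ht
    exact hs1 p t ht'
  have hcard : (T.card : ℝ) ≤ Fintype.card ι * 9 ^ D := by
    have : T.card ≤ Fintype.card ι * 9 ^ D := by
      refine (Finset.card_biUnion_le_card_mul _ _ _ fun p _ => ?_)
      exact Finset.card_image_le.trans ((hs p).trans (Nat.pow_le_pow_right (by norm_num) (hL p)))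
    exact_mod_cast this
  obtain ⟨P, hP1, hP2⟩ := exists_linearMap_of_card_le hm T hT hcard hε hε1 hmK
  refine ⟨P, fun p x hx => ?_, fun v => ?_⟩
  · exact abs_norm_sq_sub_le_of_net (s p) (hs1 p) (hsnet p) (P ∘ₗ (L p).subtype)
      (fun t ht => hP1 _ (hmem p t ht)) ⟨x, hx⟩
  · obtain ⟨u, hu, h⟩ := exists_inner_map_ge P T (η := 5 * ε)
      (norm_sub_le_norm_map_of_convex P T hT hε (fun t ht => by
        have := (abs_le.1 (hP1 t ht)).2
        rw [hT t ht] at this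
        linarith) hP2) v
    refine ⟨u, hu, fun p x hx => ?_⟩
    let ψ : L p →ₗ[ℝ] ℝ := (innerₗ _ u ∘ₗ P - innerₗ _ v) ∘ₗ (L p).subtype
    have hψ : ∀ x, ψ x = ⟪u, P x⟫ - ⟪v, (x : EuclideanSpace ℝ (Fin N))⟫ := fun x => by simp [ψ]
    have := abs_le_of_net (s p) (hsnet p) ψ.toContinuousLinearMap (c := 5 * ε * ‖v‖)
      (by positivity) (fun t ht => by
        have := h t (hmem p t ht)
        rw [LinearMap.coe_toContinuousLinearMap', hψ]
        linarith) ⟨x, hx⟩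
    rw [LinearMap.coe_toContinuousLinearMap', hψ] at this
    calc _ ≤ _ := this
      _ = 10 * ε * ‖v‖ * ‖x‖ := by rw [Submodule.coe_norm]; ring

lemma exists_dimension {n d : ℕ} (hn : 2 ≤ n) (hd : 1 ≤ d) {ε : ℝ} (hε : 0 < ε) (hε1 : ε < 1) :
    ∃ m : ℕ, 0 < m ∧ ((m + 1 : ℕ) : ℝ) ≤ 400000 * ε⁻¹ ^ 2 * (d + Real.log n) ∧
      ((Fintype.card (Fin n × Fin n) : ℝ) * 9 ^ (2 * d + 1)) *
        Real.exp (-(m * (ε / 52) ^ 2 / 8)) ≤ 1 / 4 := by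
  have hn0 : (0 : ℝ) < n := by positivity
  have hlog : 0 ≤ Real.log n := Real.log_natCast_nonneg n
  have hd' : (1 : ℝ) ≤ d := by exact_mod_cast hd
  set H := Real.log (4 * (n * n * 9 ^ (2 * d + 1))) with hH
  have hHeq : H = Real.log 4 + (2 * Real.log n + (2 * d + 1) * Real.log 9) := by
    rw [hH, Real.log_mul (by norm_num) (by positivity), Real.log_mul (by positivity)
      (by positivity), Real.log_mul hn0.ne' hn0.ne', Real.log_pow]
    push_cast
    ring
  have h4 : Real.log 4 ≤ 3 := by
    linarith [Real.log_le_sub_one_of_pos (show (0 : ℝ) < 4 by norm_num)]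
  have h9 : Real.log 9 ≤ 4 := by
    have : Real.log 9 = 2 * Real.log 3 := by
      rw [show (9 : ℝ) = 3 ^ 2 by norm_num, Real.log_pow]; push_cast; ring
    linarith [Real.log_le_sub_one_of_pos (show (0 : ℝ) < 3 by norm_num)]
  have hH1 : H ≤ 15 * (d + Real.log n) := by nlinarith
  have hH0 : 0 < H := by
    have : 0 < Real.log 4 := Real.log_pos (by norm_num)
    have : 0 < Real.log 9 := Real.log_pos (by norm_num)
    rw [hHeq]
    positivity
  set m := ⌈8 * 52 ^ 2 * ε⁻¹ ^ 2 * H⌉₊ with hm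
  have hm1 : 8 * 52 ^ 2 * ε⁻¹ ^ 2 * H ≤ m := Nat.le_ceil _
  have hm2 : (m : ℝ) < 8 * 52 ^ 2 * ε⁻¹ ^ 2 * H + 1 := Nat.ceil_lt_add_one (by positivity)
  refine ⟨m, Nat.ceil_pos.2 (by positivity), ?_, ?_⟩
  · have h1 : 1 ≤ ε⁻¹ ^ 2 := one_le_pow₀ (one_le_inv_iff₀.2 ⟨hε, hε1.le⟩)
    have h2 : 1 ≤ ε⁻¹ ^ 2 * (d + Real.log n) := by nlinarith
    have h3 : ε⁻¹ ^ 2 * H ≤ ε⁻¹ ^ 2 * (15 * (d + Real.log n)) := by gcongr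
    push_cast
    nlinarith
  · have h1 : H ≤ m * (ε / 52) ^ 2 / 8 := by
      calc H = (8 * 52 ^ 2 * ε⁻¹ ^ 2 * H) * (ε / 52) ^ 2 / 8 := by field_simp
        _ ≤ _ := by gcongr
    have h2 : Real.exp (-(m * (ε / 52) ^ 2 / 8)) ≤ Real.exp (-H) := by gcongr
    rw [Real.exp_neg H, hH, Real.exp_log (by positivity)] at h2
    rw [Fintype.card_prod, Fintype.card_fin]
    push_cast
    calc _ ≤ ((n : ℝ) * n * 9 ^ (2 * d + 1)) * (4 * ((n : ℝ) * n * 9 ^ (2 * d + 1)))⁻¹ := by gcongr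
      _ = 1 / 4 := by field_simp

theorem stmt_14 :
    ∃ C : ℝ, 0 < C ∧ ∀ (N n d : ℕ), 2 ≤ n → 1 ≤ d →
      ∀ A : Fin n → Set (EuclideanSpace ℝ (Fin N)),
      (∀ i, IsAffineOfDimLE d (A i)) →
      ∀ ε : ℝ, ε ∈ Set.Ioo (0 : ℝ) 1 →
      ∃ m : ℕ, (m : ℝ) ≤ C * ε⁻¹ ^ 2 * (d + Real.log n) ∧
      ∃ f : EuclideanSpace ℝ (Fin N) → EuclideanSpace ℝ (Fin m),
        ∀ x ∈ ⋃ i, A i, ∀ y : EuclideanSpace ℝ (Fin N),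
          (1 - ε) * ‖x - y‖ ≤ ‖f x - f y‖ ∧ ‖f x - f y‖ ≤ (1 + ε) * ‖x - y‖ := by
  refine ⟨400000, by norm_num, fun N n d hn hd A hA ε hε => ?_⟩
  obtain ⟨hε0, hε1⟩ := hε
  obtain ⟨m, hm, hmC, hmK⟩ := exists_dimension hn hd hε0 hε1
  obtain ⟨L, hL, hAL⟩ := exists_submodule_sub_mem A hA
  obtain ⟨P, hP, hext⟩ := exists_linearMap_submodules hm L hL (ε := ε / 52) (by positivity)
    (by linarith) hmK
  choose u hu hux using hext
  choose π hπ hπmin using exists_closest (by omega) A hA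
  have hπid : ∀ x ∈ ⋃ i, A i, π x = x := fun x hx => by
    have := hπmin x x hx
    rw [sub_self, norm_zero, norm_le_zero_iff, sub_eq_zero] at this
    exact this.symm
  let f : EuclideanSpace ℝ (Fin N) → EuclideanSpace ℝ (Fin (m + 1)) := fun y =>
    WithLp.toLp 2 (Fin.cons (√(‖y - π y‖ ^ 2 - ‖u (y - π y)‖ ^ 2))
      (P (π y) + u (y - π y)).ofLp)
  refine ⟨m + 1, hmC, f, fun x hx y => ?_⟩
  have hu0 : u 0 = 0 := by simpa using hu 0
  set v := y - π y with hv
  set w := π y - x with hw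
  obtain ⟨p, hp⟩ := hAL (π y) (hπ y) x hx
  have hF : ‖f x - f y‖ ^ 2 = ‖v‖ ^ 2 - ‖u v‖ ^ 2 + ‖P w + u v‖ ^ 2 := by
    rw [norm_sub_rev]
    simp only [f, ← hv]
    rw [hπid x hx, sub_self, hu0, EuclideanSpace.norm_sq_eq, Fin.sum_univ_succ]
    congr 1
    · have : ‖u v‖ ^ 2 ≤ ‖v‖ ^ 2 := by gcongr; exact hu v
      simp [Real.sq_sqrt (sub_nonneg.2 this)]
    · rw [EuclideanSpace.norm_sq_eq (P w + u v)]
      refine Finset.sum_congr rfl fun j _ => ?_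
      simp [hw]
      ring_nf
  have hxy : ‖x - y‖ ^ 2 = ‖v‖ ^ 2 + 2 * ⟪v, w⟫ + ‖w‖ ^ 2 := by
    rw [← norm_add_sq_real, norm_sub_rev]
    congr 2
    rw [hv, hw]
    abel
  have hva : ‖v‖ ≤ ‖x - y‖ := by rw [norm_sub_rev x y]; exact hπmin y x hx
  have hwa : ‖w‖ ≤ 2 * ‖x - y‖ := by
    have h1 : w = (y - x) - v := by rw [hv, hw]; abel
    have h2 := norm_sub_le (y - x) v
    rw [← h1, norm_sub_rev y x] at h2
    linarith
  set F := ‖f x - f y‖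
  set a := ‖x - y‖
  have ha : 0 ≤ a := norm_nonneg _
  have hF0 : 0 ≤ F := norm_nonneg _
  have hdiff : F ^ 2 - a ^ 2 = (‖P w‖ ^ 2 - ‖w‖ ^ 2) + 2 * (⟪u v, P w⟫ - ⟪v, w⟫) := by
    rw [hF, hxy, norm_add_sq_real, real_inner_comm]
    ring
  have h1 := abs_le.1 (hP p w hp)
  have h2 := abs_le.1 (hux v p w hp)
  have h3 : 3 * (ε / 52) * ‖w‖ ^ 2 ≤ 3 * (ε / 52) * (2 * a) ^ 2 := by gcongr
  have h4 : 10 * (ε / 52) * ‖v‖ * ‖w‖ ≤ 10 * (ε / 52) * a * (2 * a) := by gcongr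
  constructor
  · refine abs_le_of_sq_le_sq' ?_ hF0 |>.2
    nlinarith [mul_nonneg (mul_nonneg hε0.le (sub_nonneg.2 hε1.le)) (sq_nonneg a)]
  · refine abs_le_of_sq_le_sq' ?_ (by positivity) |>.2
    nlinarith [mul_nonneg (mul_nonneg hε0.le hε0.le) (sq_nonneg a), mul_nonneg hε0.le (sq_nonneg a)]
end

section
/- There exists a universal constant C > 0 with the following property. Let 1 ≤ s < N be natural numbers, let Σ_s := {x ∈ ℝ^N : x has at most s nonzero coordinates}, and let ε ∈ (0,1). Then there exist a natural number m with m ≤ C·ε^{-2}·s·log(eN/s) and a map f : ℝ^N → ℝ^m such that (1−ε)‖x−y‖₂ ≤ ‖f(x)−f(y)‖₂ ≤ (1+ε)‖x−y‖₂ for all x ∈ Σ_s and all y ∈ ℝ^N. In particular, for all z ∈ ℝ^N the quantity inf_{t∈Σ_s} ‖f(z)−f(t)‖₂ approximates the best s-term approximation error inf_{y∈Σ_s} ‖z−y‖₂ up to the relative factor 1±ε. -/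
open MeasureTheory ProbabilityTheory
open scoped RealInnerProductSpace

/-- The set of at most `s`-sparse vectors in `ℝ^N`. -/
def sparseVecs (N s : ℕ) : Set (EuclideanSpace ℝ (Fin N)) :=
  {x | ∃ t : Finset (Fin N), t.card ≤ s ∧ ∀ i ∉ t, x i = 0}

/-- The real sign attached to a Boolean. -/
def boolSign (b : Bool) : ℝ := if b then 1 else -1

/-- The Rademacher sum `∑ ±xᵢ` with the signs prescribed by `ω`. -/
def signSum {ι : Type*} [Fintype ι] (ω : ι → Bool) (x : ι → ℝ) : ℝ := ∑ i, boolSign (ω i) * x i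

section Rademacher

variable {ι : Type*} [Fintype ι] [DecidableEq ι]

lemma sum_exp_signSum_le (x : ι → ℝ) (t : ℝ) :
    ∑ ω : ι → Bool, Real.exp (t * signSum ω x)
      ≤ 2 ^ Fintype.card ι * Real.exp (t ^ 2 * (∑ i, x i ^ 2) / 2) := by
  have h1 : ∀ ω : ι → Bool, Real.exp (t * signSum ω x)
      = ∏ i, Real.exp (t * (boolSign (ω i) * x i)) := fun ω => by
    rw [signSum, Finset.mul_sum, Real.exp_sum]
  have h2 : ∑ ω : ι → Bool, Real.exp (t * signSum ω x)
      = ∏ i, ∑ b : Bool, Real.exp (t * (boolSign b * x i)) := by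
    rw [Finset.prod_univ_sum, Fintype.piFinset_univ]
    exact Finset.sum_congr rfl fun ω _ => h1 ω
  have h3 : ∀ i, ∑ b : Bool, Real.exp (t * (boolSign b * x i))
      ≤ 2 * Real.exp ((t * x i) ^ 2 / 2) := fun i => by
    have := Real.cosh_le_exp_half_sq (t * x i)
    rw [Real.cosh_eq] at this
    simp only [Fintype.sum_bool, boolSign, if_true, Bool.false_eq_true, if_false, one_mul,
      neg_one_mul, mul_neg]
    linarith
  calc _ = _ := h2
    _ ≤ ∏ i, (2 * Real.exp ((t * x i) ^ 2 / 2)) :=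
      Finset.prod_le_prod (fun i _ => by positivity) fun i _ => h3 i
    _ = _ := by
      rw [Finset.prod_mul_distrib, ← Real.exp_sum, Finset.prod_const, Finset.card_univ]
      congr 2
      rw [Finset.mul_sum, Finset.sum_div]
      exact Finset.sum_congr rfl fun i _ => by ring

lemma exp_sq_div_four_eq_integral (y : ℝ) :
    Real.exp (y ^ 2 / 4) * √Real.pi = ∫ v : ℝ, Real.exp (v * y) * Real.exp (-v ^ 2) := by
  have h : ∀ v : ℝ, Real.exp (v * y) * Real.exp (-v ^ 2)
      = Real.exp (y ^ 2 / 4) * Real.exp (-1 * (v - y / 2) ^ 2) := fun v => by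
    rw [← Real.exp_add, ← Real.exp_add]; congr 1; ring
  simp_rw [h]
  rw [integral_const_mul, integral_sub_right_eq_self (fun v : ℝ => Real.exp (-1 * v ^ 2)),
    integral_gaussian, div_one]

lemma integrable_exp_mul_mul_exp_neg_sq (y : ℝ) :
    Integrable fun v : ℝ => Real.exp (v * y) * Real.exp (-v ^ 2) := by
  have h : ∀ v : ℝ, Real.exp (v * y) * Real.exp (-v ^ 2)
      = Real.exp (y ^ 2 / 4) * Real.exp (-1 * (v - y / 2) ^ 2) := fun v => by
    rw [← Real.exp_add, ← Real.exp_add]; congr 1; ring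
  simp_rw [h]
  exact ((integrable_exp_neg_mul_sq one_pos).comp_sub_right (y / 2)).const_mul _

lemma sum_exp_sq_signSum_le (x : ι → ℝ) (hx : ∑ i, x i ^ 2 = 1) :
    ∑ ω : ι → Bool, Real.exp (signSum ω x ^ 2 / 4) ≤ 2 ^ Fintype.card ι * √2 := by
  have hpi : 0 < √Real.pi := Real.sqrt_pos.2 Real.pi_pos
  refine le_of_mul_le_mul_right ?_ hpi
  rw [Finset.sum_mul]
  simp_rw [exp_sq_div_four_eq_integral]
  rw [← integral_finsetSum _ fun ω _ => integrable_exp_mul_mul_exp_neg_sq _]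
  have hintegrable : Integrable fun v : ℝ =>
      (2 : ℝ) ^ Fintype.card ι * Real.exp (-(1 / 2) * v ^ 2) :=
    (integrable_exp_neg_mul_sq (by norm_num)).const_mul _
  calc _ ≤ ∫ v : ℝ, (2 : ℝ) ^ Fintype.card ι * Real.exp (-(1 / 2) * v ^ 2) := by
        refine integral_mono (integrable_finsetSum _ fun ω _ =>
          integrable_exp_mul_mul_exp_neg_sq _) hintegrable fun v => ?_
        simp only
        rw [← Finset.sum_mul]
        refine (mul_le_mul_of_nonneg_right (sum_exp_signSum_le x v) (by positivity)).trans_eq ?_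
        rw [hx, mul_assoc, ← Real.exp_add]
        congr 2; ring
    _ = _ := by
        rw [integral_const_mul, integral_gaussian, mul_assoc, ← Real.sqrt_mul (by norm_num)]
        congr 2; ring

lemma sum_boolSign_mul (i j : ι) :
    ∑ ω : ι → Bool, boolSign (ω i) * boolSign (ω j)
      = if i = j then (2 : ℝ) ^ Fintype.card ι else 0 := by
  split_ifs with h
  · subst h
    have : ∀ ω : ι → Bool, boolSign (ω i) * boolSign (ω i) = 1 := fun ω => by
      cases ω i <;> simp [boolSign]
    simp [this]
  · refine Finset.sum_involution (fun ω _ => Function.update ω i (!ω i)) ?_ ?_ ?_ ?_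
    · intro ω _
      rw [Function.update_self, Function.update_of_ne (Ne.symm h)]
      cases ω i <;> cases ω j <;> simp [boolSign]
    · intro ω _ _ he
      have := congrFun he i
      simp at this
    · simp
    · simp

lemma sum_signSum_sq (x : ι → ℝ) :
    ∑ ω : ι → Bool, signSum ω x ^ 2 = 2 ^ Fintype.card ι * ∑ i, x i ^ 2 := by
  simp_rw [signSum, sq, Finset.sum_mul_sum]
  rw [Finset.sum_comm, Finset.mul_sum]
  refine Finset.sum_congr rfl fun i _ => ?_
  rw [Finset.sum_comm]
  have : ∀ j, ∑ ω : ι → Bool, boolSign (ω i) * x i * (boolSign (ω j) * x j)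
      = (if i = j then (2 : ℝ) ^ Fintype.card ι else 0) * (x i * x j) := fun j => by
    rw [← sum_boolSign_mul, Finset.sum_mul]
    exact Finset.sum_congr rfl fun ω _ => by ring
  simp_rw [this]
  simp

end Rademacher

lemma Real.exp_le_one_add_add_sq_mul_exp_abs (t : ℝ) :
    Real.exp t ≤ 1 + t + t ^ 2 * Real.exp |t| := by
  have h1 : 1 ≤ Real.exp |t| := Real.one_le_exp (abs_nonneg t)
  rcases le_or_gt |t| 1 with h | h
  · have := (abs_le.1 (Real.abs_exp_sub_one_sub_id_le h)).2
    nlinarith [sq_nonneg t]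
  · rcases lt_abs.1 h with h | h
    · rw [abs_of_pos (by linarith)]
      have h2 : Real.exp t ≤ t ^ 2 * Real.exp t :=
        le_mul_of_one_le_left (Real.exp_pos t).le (by nlinarith)
      linarith
    · have : Real.exp t ≤ 1 := Real.exp_le_one_iff.2 (by linarith)
      nlinarith

lemma exp_mul_sub_one_le {l y : ℝ} (hl : |l| ≤ 1 / 8) (hy : 0 ≤ y) :
    Real.exp (l * (y - 1))
      ≤ 1 + l * (y - 1) + 128 * l ^ 2 * (√2 * Real.exp (y / 4)) := by
  refine (Real.exp_le_one_add_add_sq_mul_exp_abs _).trans ?_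
  have hw : |y - 1| ≤ y + 1 := abs_le.2 ⟨by linarith, by linarith⟩
  set u := |y - 1| / 8 with hu
  have hu0 : 0 ≤ u := by positivity
  have h1 : |l * (y - 1)| ≤ u := by
    rw [abs_mul, hu]
    nlinarith [abs_nonneg (y - 1)]
  have h2 : u ^ 2 / 2 ≤ Real.exp u := by
    simpa using Real.pow_div_factorial_le_exp u hu0 2
  have h3 : (y - 1) ^ 2 = 64 * u ^ 2 := by rw [hu, div_pow, sq_abs]; ring
  have h4 : Real.exp (1 / 4) ≤ √2 := by
    refine Real.le_sqrt_of_sq_le ?_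
    rw [← Real.exp_nat_mul, ← Real.le_log_iff_exp_le two_pos]
    have := Real.log_two_gt_d9
    norm_num at this ⊢
    linarith
  have h5 : Real.exp u * Real.exp u ≤ √2 * Real.exp (y / 4) := by
    calc _ ≤ Real.exp (1 / 4) * Real.exp (y / 4) := by
          rw [← Real.exp_add, ← Real.exp_add]
          refine Real.exp_le_exp.2 ?_
          rw [hu]; linarith
      _ ≤ _ := by gcongr
  have h6 : (l * (y - 1)) ^ 2 * Real.exp |l * (y - 1)|
      ≤ 128 * l ^ 2 * (√2 * Real.exp (y / 4)) := by
    calc _ ≤ (l * (y - 1)) ^ 2 * Real.exp u := by gcongr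
      _ = l ^ 2 * (64 * u ^ 2) * Real.exp u := by rw [← h3]; ring
      _ ≤ l ^ 2 * (64 * (2 * Real.exp u)) * Real.exp u := by gcongr; linarith
      _ = 128 * l ^ 2 * (Real.exp u * Real.exp u) := by ring
      _ ≤ _ := by gcongr
  linarith

lemma sum_exp_mul_signSum_sq_sub_one_le {ι : Type*} [Fintype ι] [DecidableEq ι] {x : ι → ℝ}
    (hx : ∑ i, x i ^ 2 = 1) {l : ℝ} (hl : |l| ≤ 1 / 8) :
    ∑ ω : ι → Bool, Real.exp (l * (signSum ω x ^ 2 - 1))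
      ≤ 2 ^ Fintype.card ι * Real.exp (256 * l ^ 2) := by
  calc _ ≤ ∑ ω : ι → Bool, (1 + l * (signSum ω x ^ 2 - 1)
        + 128 * l ^ 2 * (√2 * Real.exp (signSum ω x ^ 2 / 4))) :=
        Finset.sum_le_sum fun ω _ => exp_mul_sub_one_le hl (sq_nonneg _)
    _ = 2 ^ Fintype.card ι
        + 128 * l ^ 2 * (√2 * ∑ ω : ι → Bool, Real.exp (signSum ω x ^ 2 / 4)) := by
        rw [Finset.sum_add_distrib, Finset.sum_add_distrib, ← Finset.mul_sum, ← Finset.mul_sum,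
          ← Finset.mul_sum, Finset.sum_sub_distrib, sum_signSum_sq, hx]
        simp
    _ ≤ 2 ^ Fintype.card ι + 128 * l ^ 2 * (√2 * (2 ^ Fintype.card ι * √2)) := by
        gcongr
        exact sum_exp_sq_signSum_le x hx
    _ = 2 ^ Fintype.card ι * (256 * l ^ 2 + 1) := by
        have : √2 * √2 = (2 : ℝ) := Real.mul_self_sqrt (by norm_num)
        linear_combination (128 * l ^ 2 * 2 ^ Fintype.card ι) * this
    _ ≤ _ := by gcongr; exact Real.add_one_le_exp _

lemma sum_exp_mul_sum_signSum_sq_sub_one_le {κ ι : Type*} [Fintype κ] [DecidableEq κ]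
    [Fintype ι] [DecidableEq ι] {x : ι → ℝ}
    (hx : ∑ i, x i ^ 2 = 1) {l : ℝ} (hl : |l| ≤ 1 / 8) :
    ∑ ω : κ → ι → Bool, Real.exp (l * ∑ k, (signSum (ω k) x ^ 2 - 1))
      ≤ Fintype.card (κ → ι → Bool) * Real.exp (256 * Fintype.card κ * l ^ 2) := by
  have h2 : ∑ ω : κ → ι → Bool, Real.exp (l * ∑ k, (signSum (ω k) x ^ 2 - 1))
      = ∏ _k : κ, ∑ ω : ι → Bool, Real.exp (l * (signSum ω x ^ 2 - 1)) := by
    rw [Finset.prod_univ_sum, Fintype.piFinset_univ]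
    refine Finset.sum_congr rfl fun ω _ => ?_
    rw [Finset.mul_sum, Real.exp_sum]
  rw [h2, Finset.prod_const, Finset.card_univ]
  refine (pow_le_pow_left₀ (by positivity) (sum_exp_mul_signSum_sq_sub_one_le hx hl) _).trans_eq ?_
  rw [mul_pow, ← Real.exp_nat_mul]
  simp only [Fintype.card_pi, Fintype.card_bool, Finset.prod_const, Finset.card_univ]
  push_cast
  congr 2; ring

/-- The deviation functional whose value below one forces
`|∑ₖ (signSum (ω k) x ^ 2 - 1)| ≤ m η`. -/
noncomputable def deviationWeight {m : ℕ} {ι : Type*} [Fintype ι] (η : ℝ) (x : ι → ℝ)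
    (ω : Fin m → ι → Bool) : ℝ :=
  Real.exp (min η 1 / 512 * (∑ k, (signSum (ω k) x ^ 2 - 1)) - min η 1 / 512 * (m * η))
    + Real.exp (-(min η 1 / 512) * (∑ k, (signSum (ω k) x ^ 2 - 1)) - min η 1 / 512 * (m * η))

lemma abs_le_of_deviationWeight_lt_one {m : ℕ} {ι : Type*} [Fintype ι] {η : ℝ} (hη : 0 < η)
    {x : ι → ℝ} {ω : Fin m → ι → Bool} (h : deviationWeight η x ω < 1) :
    |∑ k, (signSum (ω k) x ^ 2 - 1)| ≤ m * η := by
  have hl : 0 < min η 1 / 512 := by positivity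
  have h1 := Real.exp_pos
    (min η 1 / 512 * (∑ k, (signSum (ω k) x ^ 2 - 1)) - min η 1 / 512 * (m * η))
  have h2 := Real.exp_pos
    (-(min η 1 / 512) * (∑ k, (signSum (ω k) x ^ 2 - 1)) - min η 1 / 512 * (m * η))
  rw [deviationWeight] at h
  have h3 := Real.exp_lt_one_iff.1 (lt_of_le_of_lt (le_add_of_nonneg_right h2.le) h)
  have h4 := Real.exp_lt_one_iff.1 (lt_of_le_of_lt (le_add_of_nonneg_left h1.le) h)
  refine abs_le.2 ⟨?_, ?_⟩
  · refine le_of_mul_le_mul_left ?_ hl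
    linarith
  · refine le_of_mul_le_mul_left ?_ hl
    linarith

lemma sum_deviationWeight_le {m : ℕ} {ι : Type*} [Fintype ι] [DecidableEq ι] {η : ℝ}
    (hη : 0 < η) {x : ι → ℝ} (hx : ∑ i, x i ^ 2 = 1) :
    ∑ ω : Fin m → ι → Bool, deviationWeight η x ω
      ≤ Fintype.card (Fin m → ι → Bool) * (2 * Real.exp (-(m * (min η 1 * η) / 1024))) := by
  set l := min η 1 / 512 with hl
  have hmin : 0 < min η 1 := by positivity
  have hl0 : |l| ≤ 1 / 8 := by
    rw [abs_of_pos (by positivity), hl]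
    linarith [min_le_right η 1]
  have key : Real.exp (256 * m * l ^ 2) * Real.exp (-(l * (m * η)))
      ≤ Real.exp (-(m * (min η 1 * η) / 1024)) := by
    rw [← Real.exp_add]
    refine Real.exp_le_exp.2 ?_
    rw [hl]
    have : (m : ℝ) * min η 1 * (min η 1) ≤ m * min η 1 * η := by
      gcongr; exact min_le_left _ _
    linarith
  have h1 := sum_exp_mul_sum_signSum_sq_sub_one_le (κ := Fin m) hx hl0
  have h2 := sum_exp_mul_sum_signSum_sq_sub_one_le (κ := Fin m) hx (l := -l) (by rwa [abs_neg])
  rw [neg_sq] at h2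
  rw [Fintype.card_fin] at h1 h2
  simp only [deviationWeight, ← hl]
  simp_rw [sub_eq_add_neg _ (l * (m * η)), Real.exp_add]
  rw [Finset.sum_add_distrib, ← Finset.sum_mul, ← Finset.sum_mul]
  have h3 := mul_le_mul_of_nonneg_right (add_le_add h1 h2) (Real.exp_pos (-(l * (m * η)))).le
  have h4 := mul_le_mul_of_nonneg_left key
    (Nat.cast_nonneg (α := ℝ) (Fintype.card (Fin m → ι → Bool)))
  linarith

/-- The normalized linear map `m^{-1/2} (±1)` with signs `ω`. -/
noncomputable def signMap {m N : ℕ} (ω : Fin m → Fin N → Bool) :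
    EuclideanSpace ℝ (Fin N) →ₗ[ℝ] EuclideanSpace ℝ (Fin m) where
  toFun x := (√m)⁻¹ • WithLp.toLp 2 fun k => signSum (ω k) x
  map_add' x y := by
    ext k
    simp [signSum, mul_add, Finset.sum_add_distrib]
  map_smul' c x := by
    ext k
    simp only [PiLp.smul_apply, smul_eq_mul, RingHom.id_apply, signSum]
    rw [Finset.mul_sum, Finset.mul_sum, Finset.mul_sum]
    exact Finset.sum_congr rfl fun i _ => by ring

lemma norm_signMap_sq {m N : ℕ} (ω : Fin m → Fin N → Bool) (x : EuclideanSpace ℝ (Fin N)) :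
    ‖signMap ω x‖ ^ 2 = (m : ℝ)⁻¹ * ∑ k, signSum (ω k) x ^ 2 := by
  change ‖(√m)⁻¹ • WithLp.toLp 2 fun k => signSum (ω k) x‖ ^ 2 = _
  rw [norm_smul, mul_pow, EuclideanSpace.norm_sq_eq]
  simp

/-- Finitely many prescribed vectors are simultaneously almost isometrically embedded, provided
that the union bound over their failure probabilities is nontrivial. -/
lemma exists_linearMap_forall_abs_norm_sq_sub_le {m N : ℕ} (hm : 0 < m) (I : Finset ℕ)
    (V : ℕ → Finset (EuclideanSpace ℝ (Fin N))) (η : ℕ → ℝ) (hη : ∀ n ∈ I, 0 < η n)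
    (hsum : ∑ n ∈ I, (V n).card * (2 * Real.exp (-(m * (min (η n) 1 * η n) / 1024))) < 1) :
    ∃ P : EuclideanSpace ℝ (Fin N) →ₗ[ℝ] EuclideanSpace ℝ (Fin m),
      ∀ n ∈ I, ∀ v ∈ V n, |‖P v‖ ^ 2 - ‖v‖ ^ 2| ≤ η n * ‖v‖ ^ 2 := by
  classical
  set V' : ℕ → Finset (EuclideanSpace ℝ (Fin N)) := fun n => (V n).filter (· ≠ 0) with hV'
  have hunit : ∀ v : EuclideanSpace ℝ (Fin N), v ≠ 0 → ∑ i, (‖v‖⁻¹ • v) i ^ 2 = 1 := by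
    intro v hv
    have h := EuclideanSpace.norm_sq_eq (‖v‖⁻¹ • v)
    rw [norm_smul, norm_inv, norm_norm, inv_mul_cancel₀ (norm_ne_zero_iff.2 hv)] at h
    simpa [mul_pow, sq_abs] using h.symm
  obtain ⟨ω, -, hω⟩ : ∃ ω ∈ (Finset.univ : Finset (Fin m → Fin N → Bool)),
      ∑ n ∈ I, ∑ v ∈ V' n, deviationWeight (η n) (‖v‖⁻¹ • v) ω < 1 := by
    refine Finset.exists_lt_of_sum_lt ?_
    rw [Finset.sum_const, Finset.card_univ, nsmul_one, Finset.sum_comm]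
    have hcard : (0 : ℝ) < Fintype.card (Fin m → Fin N → Bool) := by
      exact_mod_cast Fintype.card_pos
    calc _ ≤ ∑ n ∈ I, (Fintype.card (Fin m → Fin N → Bool) : ℝ)
          * ((V n).card * (2 * Real.exp (-(m * (min (η n) 1 * η n) / 1024)))) := by
          refine Finset.sum_le_sum fun n hn => ?_
          rw [Finset.sum_comm]
          calc _ ≤ ∑ v ∈ V' n, (Fintype.card (Fin m → Fin N → Bool) : ℝ)
                * (2 * Real.exp (-(m * (min (η n) 1 * η n) / 1024))) :=
                Finset.sum_le_sum fun v hv =>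
                  sum_deviationWeight_le (hη n hn) (hunit v (Finset.mem_filter.1 hv).2)
            _ ≤ _ := by
                rw [Finset.sum_const, nsmul_eq_mul, mul_left_comm]
                gcongr
                exact Finset.filter_subset _ _
      _ < _ := by
          rw [← Finset.mul_sum]
          exact mul_lt_of_lt_one_right hcard hsum
  refine ⟨signMap ω, fun n hn v hv => ?_⟩
  by_cases hv0 : v = 0
  · simp [hv0]
  have hpos : ∀ n' (v' : EuclideanSpace ℝ (Fin N)),
      0 ≤ deviationWeight (η n') (‖v'‖⁻¹ • v') ω := fun n' v' => by
    rw [deviationWeight]; positivity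
  have h1 : deviationWeight (η n) (‖v‖⁻¹ • v) ω < 1 := by
    refine lt_of_le_of_lt ?_ hω
    refine le_trans ?_ (Finset.single_le_sum
      (f := fun n => ∑ v ∈ V' n, deviationWeight (η n) (‖v‖⁻¹ • v) ω)
      (fun n' _ => Finset.sum_nonneg fun v' _ => hpos n' v') hn)
    exact Finset.single_le_sum (f := fun v : EuclideanSpace ℝ (Fin N) =>
      deviationWeight (η n) (‖v‖⁻¹ • v) ω) (fun v' _ => hpos n v')
      (Finset.mem_filter.2 ⟨hv, hv0⟩)
  have h2 := abs_le_of_deviationWeight_lt_one (hη n hn) h1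
  have hm' : (0 : ℝ) < m := by exact_mod_cast hm
  have hvn : 0 < ‖v‖ := norm_pos_iff.2 hv0
  have h3 : ∀ k, signSum (ω k) (‖v‖⁻¹ • v) ^ 2 = (‖v‖ ^ 2)⁻¹ * signSum (ω k) v ^ 2 := fun k => by
    have : signSum (ω k) (‖v‖⁻¹ • v) = ‖v‖⁻¹ * signSum (ω k) v := by
      rw [signSum, signSum, Finset.mul_sum]
      exact Finset.sum_congr rfl fun i _ => mul_left_comm _ _ _
    rw [this, mul_pow, inv_pow]
  have h4 : ‖signMap ω v‖ ^ 2 - ‖v‖ ^ 2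
      = ‖v‖ ^ 2 * (m : ℝ)⁻¹ * ∑ k, (signSum (ω k) (‖v‖⁻¹ • v) ^ 2 - 1) := by
    simp_rw [h3]
    rw [Finset.sum_sub_distrib, ← Finset.mul_sum, norm_signMap_sq]
    simp only [Finset.sum_const, Finset.card_univ, Fintype.card_fin, nsmul_eq_mul, mul_one]
    field_simp
  rw [h4, abs_mul, abs_of_pos (by positivity)]
  calc _ ≤ ‖v‖ ^ 2 * (m : ℝ)⁻¹ * (m * η n) := mul_le_mul_of_nonneg_left h2 (by positivity)
    _ = _ := by field_simp

/-- The unit ball of a `d`-dimensional normed space has a `1/2`-net of cardinality at most `5 ^ d`. -/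
lemma exists_half_net (E : Type*) [NormedAddCommGroup E] [NormedSpace ℝ E]
    [FiniteDimensional ℝ E] :
    ∃ F : Finset E, F.card ≤ 5 ^ Module.finrank ℝ E ∧ (∀ v ∈ F, ‖v‖ ≤ 1) ∧
      ∀ x : E, ‖x‖ ≤ 1 → ∃ v ∈ F, ‖x - v‖ ≤ 1 / 2 := by
  classical
  let p : ℕ → Prop := fun k => ∃ F : Finset E, F.card = k ∧ (∀ v ∈ F, ‖v‖ ≤ 1) ∧
    ∀ c ∈ F, ∀ d ∈ F, c ≠ d → 1 / 2 ≤ ‖c - d‖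
  have hbound : ∀ F : Finset E, (∀ v ∈ F, ‖v‖ ≤ 1) →
      (∀ c ∈ F, ∀ d ∈ F, c ≠ d → 1 / 2 ≤ ‖c - d‖) → F.card ≤ 5 ^ Module.finrank ℝ E := by
    intro F h1 h2
    have hinj : Function.Injective fun v : E => (2 : ℝ) • v :=
      smul_right_injective E two_ne_zero
    rw [← Finset.card_image_of_injective F hinj]
    refine Besicovitch.card_le_of_separated _ ?_ ?_
    · simp only [Finset.forall_mem_image, norm_smul]
      intro v hv
      norm_num
      linarith [h1 v hv]
    · simp only [Finset.forall_mem_image, ← smul_sub, norm_smul]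
      intro c hc d hd hcd
      have := h2 c hc d hd fun h => hcd (by rw [h])
      norm_num
      linarith
  have h0 : p 0 := ⟨∅, by simp⟩
  obtain ⟨F, hF, h1, h2⟩ := Nat.findGreatest_spec (P := p) (Nat.zero_le (5 ^ Module.finrank ℝ E)) h0
  refine ⟨F, hbound F h1 h2, h1, fun x hx => ?_⟩
  by_contra! hcon
  have hxF : x ∉ F := fun h => by
    have := hcon x h
    norm_num at this
  have hins1 : ∀ v ∈ insert x F, ‖v‖ ≤ 1 := by
    intro v hv
    rcases Finset.mem_insert.1 hv with rfl | hv
    exacts [hx, h1 v hv]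
  have hins2 : ∀ c ∈ insert x F, ∀ d ∈ insert x F, c ≠ d → 1 / 2 ≤ ‖c - d‖ := by
    intro c hc d hd hcd
    rcases Finset.mem_insert.1 hc with rfl | hc' <;> rcases Finset.mem_insert.1 hd with rfl | hd'
    · exact absurd rfl hcd
    · exact (hcon d hd').le
    · rw [norm_sub_rev]; exact (hcon c hc').le
    · exact h2 c hc' d hd' hcd
  have h3 : p (insert x F).card := ⟨_, rfl, hins1, hins2⟩
  have := Nat.le_findGreatest (hbound _ hins1 hins2) h3
  rw [Finset.card_insert_of_notMem hxF, hF] at this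
  omega

lemma abs_le_of_half_net {E : Type*} [NormedAddCommGroup E] [NormedSpace ℝ E]
    [FiniteDimensional ℝ E] {F : Finset E}
    (hF : ∀ x : E, ‖x‖ ≤ 1 → ∃ v ∈ F, ‖x - v‖ ≤ 1 / 2) (φ : E →ₗ[ℝ] ℝ) {K : ℝ} (hK : 0 ≤ K)
    (h : ∀ v ∈ F, |φ v| ≤ K) (x : E) : |φ x| ≤ 2 * K * ‖x‖ := by
  set ψ : E →L[ℝ] ℝ := LinearMap.toContinuousLinearMap φ
  have h1 : ‖ψ‖ ≤ K + 1 / 2 * ‖ψ‖ := by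
    refine ψ.opNorm_le_of_unit_norm (by positivity) fun y hy => ?_
    obtain ⟨v, hv, hyv⟩ := hF y hy.le
    have e : ψ y = ψ v + ψ (y - v) := by rw [map_sub]; ring
    rw [e]
    refine (norm_add_le _ _).trans (add_le_add (h v hv) ?_)
    refine (ψ.le_opNorm _).trans ?_
    rw [mul_comm]
    gcongr
  have h2 : ‖ψ x‖ ≤ ‖ψ‖ * ‖x‖ := ψ.le_opNorm x
  refine h2.trans ?_
  gcongr
  linarith

/-- Near-isometry on a suitable finite set of vectors implies the restricted bilinear bound on
a whole subspace. -/
lemma exists_finset_forall_abs_inner_sub_le {E : Type*} [NormedAddCommGroup E]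
    [InnerProductSpace ℝ E] (M : Submodule ℝ E) [FiniteDimensional ℝ M] :
    ∃ W : Finset E, W.card ≤ 2 * 25 ^ Module.finrank ℝ M ∧
      ∀ {G : Type} [NormedAddCommGroup G] [InnerProductSpace ℝ G] (P : E →ₗ[ℝ] G) (η : ℝ),
        0 ≤ η → (∀ v ∈ W, |‖P v‖ ^ 2 - ‖v‖ ^ 2| ≤ η * ‖v‖ ^ 2) →
        ∀ x ∈ M, ∀ y ∈ M, |⟪P x, P y⟫ - ⟪x, y⟫| ≤ 4 * η * ‖x‖ * ‖y‖ := by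
  classical
  obtain ⟨F, hcard, hF1, hF⟩ := exists_half_net M
  refine ⟨(F ×ˢ F).image (fun p => (p.1 : E) + p.2) ∪ (F ×ˢ F).image (fun p => (p.1 : E) - p.2),
    ?_, ?_⟩
  · refine (Finset.card_union_le _ _).trans ?_
    have h1 : (F ×ˢ F).card ≤ 25 ^ Module.finrank ℝ M := by
      rw [Finset.card_product, show 25 = 5 * 5 from rfl, mul_pow]
      exact Nat.mul_le_mul hcard hcard
    have h2 := Finset.card_image_le (s := F ×ˢ F) (f := fun p => (p.1 : E) + p.2)
    have h3 := Finset.card_image_le (s := F ×ˢ F) (f := fun p => (p.1 : E) - p.2)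
    omega
  · intro G _ _ P η hη hW x hx y hy
    have hpq : ∀ p ∈ F, ∀ q ∈ F, |⟪P p, P q⟫ - ⟪(p : E), (q : E)⟫| ≤ η := by
      intro p hp q hq
      have ha := hW (p + q) (Finset.mem_union_left _
        (Finset.mem_image.2 ⟨(p, q), Finset.mem_product.2 ⟨hp, hq⟩, rfl⟩))
      have hb := hW (p - q) (Finset.mem_union_right _
        (Finset.mem_image.2 ⟨(p, q), Finset.mem_product.2 ⟨hp, hq⟩, rfl⟩))
      have hp1 : ‖(p : E)‖ ≤ 1 := hF1 p hp
      have hq1 : ‖(q : E)‖ ≤ 1 := hF1 q hq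
      have hp2 : ‖(p : E)‖ ^ 2 ≤ 1 := pow_le_one₀ (norm_nonneg _) hp1
      have hq2 : ‖(q : E)‖ ^ 2 ≤ 1 := pow_le_one₀ (norm_nonneg _) hq1
      rw [map_add] at ha
      rw [map_sub] at hb
      rw [norm_add_sq_real, norm_add_sq_real] at ha
      rw [norm_sub_sq_real, norm_sub_sq_real] at hb
      rw [abs_le] at ha hb ⊢
      have h1 := mul_le_mul_of_nonneg_left hp2 hη
      have h2 := mul_le_mul_of_nonneg_left hq2 hη
      constructor <;> linarith
    let φ : M → M →ₗ[ℝ] ℝ := fun p =>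
      (innerₗ G (P p)) ∘ₗ P ∘ₗ M.subtype - (innerₗ E (p : E)) ∘ₗ M.subtype
    have hφ : ∀ p q : M, φ p q = ⟪P p, P q⟫ - ⟪(p : E), (q : E)⟫ := fun p q => rfl
    have hsymm : ∀ p q : M, φ p q = φ q p := fun p q => by
      rw [hφ, hφ, real_inner_comm, real_inner_comm (p : E)]
    have h1 : ∀ p ∈ F, ∀ z : M, |φ p z| ≤ 2 * η * ‖z‖ := fun p hp z =>
      abs_le_of_half_net hF (φ p) hη (fun q hq => hpq p hp q hq) z
    have h2 := abs_le_of_half_net hF (φ ⟨x, hx⟩) (K := 2 * η * ‖x‖) (by positivity)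
      (fun v hv => by rw [hsymm]; exact h1 v hv ⟨x, hx⟩) ⟨y, hy⟩
    rw [hφ] at h2
    refine h2.trans_eq ?_
    rw [Submodule.coe_norm]
    ring

/-- The coordinate subspace of vectors supported on `S`. -/
def supportedOn {N : ℕ} (S : Finset (Fin N)) : Submodule ℝ (EuclideanSpace ℝ (Fin N)) where
  carrier := {x | ∀ i ∉ S, x i = 0}
  add_mem' {x y} hx hy i hi := by simp [hx i hi, hy i hi]
  zero_mem' i _ := rfl
  smul_mem' c x hx i hi := by simp [hx i hi]

lemma supportedOn_mono {N : ℕ} {S T : Finset (Fin N)} (h : S ⊆ T) :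
    supportedOn S ≤ supportedOn T := fun _ hx i hi => hx i fun hS => hi (h hS)

lemma finrank_supportedOn_le {N : ℕ} (S : Finset (Fin N)) :
    Module.finrank ℝ (supportedOn S) ≤ S.card := by
  let r : supportedOn S →ₗ[ℝ] (S → ℝ) :=
    { toFun := fun x i => (x : EuclideanSpace ℝ (Fin N)) i
      map_add' := fun _ _ => rfl
      map_smul' := fun _ _ => rfl }
  have hr : Function.Injective r := by
    intro x y hxy
    ext i
    by_cases hi : i ∈ S
    · exact congrFun hxy ⟨i, hi⟩
    · rw [x.2 i hi, y.2 i hi]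
  simpa using LinearMap.finrank_le_finrank_of_injective hr

lemma choose_le_exp_mul_log {N s n : ℕ} (hs : 1 ≤ s) (hsn : s ≤ n) (hnN : n ≤ N) :
    (N.choose n : ℝ) ≤ Real.exp (n * Real.log (Real.exp 1 * N / s)) := by
  have hs' : (0 : ℝ) < s := by exact_mod_cast hs
  have hn' : (0 : ℝ) < n := by exact_mod_cast hs.trans hsn
  have hN' : (0 : ℝ) < N := by exact_mod_cast (hs.trans hsn).trans hnN
  have h1 : (n : ℝ) ^ n / n.factorial ≤ Real.exp n :=
    Real.pow_div_factorial_le_exp _ hn'.le n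
  rw [Real.exp_nat_mul, Real.exp_log (by positivity)]
  calc (N.choose n : ℝ) ≤ (N : ℝ) ^ n / n.factorial := Nat.choose_le_pow_div n N
    _ = (N / n) ^ n * ((n : ℝ) ^ n / n.factorial) := by
        rw [div_pow]; field_simp
    _ ≤ (N / n) ^ n * Real.exp n := by gcongr
    _ = (Real.exp 1 * N / n) ^ n := by
        rw [← Real.exp_one_pow, ← mul_pow]; congr 1; ring
    _ ≤ _ := by gcongr

/-- The distortion allowed at sparsity level `n`. -/
noncomputable def levelDistortion (s : ℕ) (δ : ℝ) (n : ℕ) : ℝ :=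
  max (δ * √(n / s)) (δ ^ 2 * (n / s))

lemma sq_mul_div_le_min_mul_levelDistortion {s n : ℕ} {δ : ℝ} (hδ : 0 ≤ δ) :
    δ ^ 2 * (n / s) ≤ min (levelDistortion s δ n) 1 * levelDistortion s δ n := by
  have h1 : δ * √(n / s) ≤ levelDistortion s δ n := le_max_left _ _
  have h2 : δ ^ 2 * (n / s) ≤ levelDistortion s δ n := le_max_right _ _
  have h0 : 0 ≤ δ * √(n / s) := by positivity
  have hsq : (δ * √(n / s)) ^ 2 = δ ^ 2 * (n / s) := by
    rw [mul_pow, Real.sq_sqrt (by positivity)]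
  rcases le_total (levelDistortion s δ n) 1 with h | h
  · rw [min_eq_left h, ← hsq, sq]
    exact mul_self_le_mul_self h0 h1
  · rwa [min_eq_right h, one_mul]

/-- A linear map which satisfies the restricted isometry property at all sparsity levels `n ≥ s`,
with distortion growing with `n`. -/
def MultiRIP {N m : ℕ} (s : ℕ) (δ : ℝ)
    (P : EuclideanSpace ℝ (Fin N) →ₗ[ℝ] EuclideanSpace ℝ (Fin m)) : Prop :=
  ∀ n, s ≤ n → n ≤ N → ∀ S : Finset (Fin N), S.card ≤ n →
    ∀ x ∈ supportedOn S, ∀ y ∈ supportedOn S,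
      |⟪P x, P y⟫ - ⟪x, y⟫| ≤ 4 * levelDistortion s δ n * ‖x‖ * ‖y‖

lemma exists_multiRIP {N s m : ℕ} (hs : 1 ≤ s) (hsN : s ≤ N) {δ : ℝ} (hδ : 0 < δ)
    (hm : 9216 * (δ⁻¹ ^ 2 * s * Real.log (Real.exp 1 * N / s)) ≤ m) :
    ∃ P : EuclideanSpace ℝ (Fin N) →ₗ[ℝ] EuclideanSpace ℝ (Fin m), MultiRIP s δ P := by
  classical
  have hs' : (0 : ℝ) < s := by exact_mod_cast hs
  have hN' : (0 : ℝ) < N := by exact_mod_cast hs.trans hsN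
  set L := Real.log (Real.exp 1 * N / s) with hL
  have hL1 : 1 ≤ L := by
    rw [hL, Real.le_log_iff_exp_le (by positivity), le_div_iff₀ hs']
    gcongr
  have hL0 : 0 < L := one_pos.trans_le hL1
  have hm0 : (0 : ℝ) < m := lt_of_lt_of_le
    (mul_pos (by norm_num) (mul_pos (mul_pos (pow_pos (inv_pos.2 hδ) 2) hs') hL0)) hm
  choose W hWcard hW using fun S : Finset (Fin N) =>
    exists_finset_forall_abs_inner_sub_le (supportedOn S)
  set V : ℕ → Finset (EuclideanSpace ℝ (Fin N)) := fun n =>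
    (Finset.powersetCard n Finset.univ).biUnion W with hV
  have hVcard : ∀ n, (V n).card ≤ N.choose n * (2 * 25 ^ n) := fun n => by
    have h := Finset.card_biUnion_le_card_mul (Finset.powersetCard n (Finset.univ : Finset (Fin N)))
      W (2 * 25 ^ n) fun S hS => (hWcard S).trans (by
        gcongr
        · norm_num
        · exact (finrank_supportedOn_le S).trans_eq (Finset.mem_powersetCard.1 hS).2)
    simpa using h
  have hη : ∀ n ∈ Finset.Icc s N, 0 < levelDistortion s δ n := fun n hn => by
    have : (0 : ℝ) < n := by exact_mod_cast hs.trans (Finset.mem_Icc.1 hn).1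
    exact lt_max_of_lt_left (by positivity)
  have hterm : ∀ n ∈ Finset.Icc s N,
      (V n).card * (2 * Real.exp (-(m * (min (levelDistortion s δ n) 1
        * levelDistortion s δ n) / 1024))) ≤ (1 / 2 : ℝ) ^ n := by
    intro n hn
    obtain ⟨hsn, hnN⟩ := Finset.mem_Icc.1 hn
    have hn1 : (1 : ℝ) ≤ n := by exact_mod_cast hs.trans hsn
    have h1 : ((V n).card : ℝ) ≤ N.choose n * (2 * 25 ^ n) := by exact_mod_cast hVcard n
    have h2 := choose_le_exp_mul_log hs hsn hnN
    have h3 : 9216 * (n * L) ≤ m * (δ ^ 2 * (n / s)) := by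
      calc 9216 * (n * L) = 9216 * (δ⁻¹ ^ 2 * s * L) * (δ ^ 2 * (n / s)) := by field_simp
        _ ≤ _ := by gcongr
    have h4 : -(m * (min (levelDistortion s δ n) 1 * levelDistortion s δ n) / 1024)
        ≤ -(9 * (n * L)) := by
      have := mul_le_mul_of_nonneg_left
        (sq_mul_div_le_min_mul_levelDistortion (s := s) (n := n) hδ.le) hm0.le
      linarith
    have he : (2 : ℝ) ≤ Real.exp 1 := by linarith [Real.exp_one_gt_d9]
    have h25 : (25 : ℝ) ≤ Real.exp 1 ^ 5 := by
      calc (25 : ℝ) ≤ 2 ^ 5 := by norm_num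
        _ ≤ _ := by gcongr
    have h4' : (4 : ℝ) ≤ Real.exp 1 ^ (2 * n) := by
      calc (4 : ℝ) = 2 ^ 2 := by norm_num
        _ ≤ 2 ^ (2 * n) := by
          gcongr
          · norm_num
          · have := hs.trans hsn; omega
        _ ≤ _ := by gcongr
    calc _ ≤ Real.exp (n * L) * (2 * (Real.exp 1 ^ 5) ^ n) * (2 * Real.exp (-(9 * (n * L)))) := by
          gcongr
          exact h1.trans (by gcongr)
      _ = 4 * (Real.exp (n * L) * (Real.exp 1 ^ 5) ^ n * Real.exp (-(9 * (n * L)))) := by ring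
      _ ≤ Real.exp 1 ^ (2 * n)
          * (Real.exp (n * L) * (Real.exp 1 ^ 5) ^ n * Real.exp (-(9 * (n * L)))) := by gcongr
      _ = Real.exp (7 * n - 8 * (n * L)) := by
          rw [← pow_mul, ← Real.exp_nat_mul, ← Real.exp_nat_mul, ← Real.exp_add, ← Real.exp_add,
            ← Real.exp_add]
          congr 1; push_cast; ring
      _ ≤ Real.exp (-n) := by
          refine Real.exp_le_exp.2 ?_
          nlinarith
      _ = (Real.exp 1)⁻¹ ^ n := by
          rw [inv_pow, Real.exp_one_pow, Real.exp_neg]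
      _ ≤ _ := by
          gcongr
          rw [one_div]
          gcongr
  obtain ⟨P, hP⟩ := exists_linearMap_forall_abs_norm_sq_sub_le (m := m) (by exact_mod_cast hm0)
    (Finset.Icc s N) V (levelDistortion s δ) hη (by
      refine (Finset.sum_le_sum hterm).trans_lt ?_
      have hsub : Finset.Icc s N ⊆ (Finset.range (N + 1)).erase 0 := fun n hn => by
        rw [Finset.mem_Icc] at hn
        rw [Finset.mem_erase, Finset.mem_range]
        omega
      refine (Finset.sum_le_sum_of_subset_of_nonneg hsub fun _ _ _ => by positivity).trans_lt ?_
      have h := Finset.add_sum_erase (Finset.range (N + 1)) (fun n => (1 / 2 : ℝ) ^ n)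
        (Finset.mem_range.2 (Nat.succ_pos N))
      have h2 : ∑ n ∈ Finset.range (N + 1), (1 / 2 : ℝ) ^ n < 2 := by
        rw [geom_sum_eq (by norm_num), div_lt_iff_of_neg (by norm_num)]
        have : (0 : ℝ) < (1 / 2) ^ (N + 1) := by positivity
        linarith
      simp only [pow_zero] at h
      linarith)
  refine ⟨P, fun n hsn hnN S hS x hx y hy => ?_⟩
  obtain ⟨T, hST, hT⟩ := Finset.exists_superset_card_eq hS (by simpa using hnN)
  have hn : n ∈ Finset.Icc s N := Finset.mem_Icc.2 ⟨hsn, hnN⟩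
  exact hW T P _ (hη n hn).le (fun v hv => hP n hn v (Finset.mem_biUnion.2
    ⟨T, Finset.mem_powersetCard.2 ⟨Finset.subset_univ _, hT⟩, hv⟩))
    x (supportedOn_mono hST hx) y (supportedOn_mono hST hy)

lemma norm_le_mul_sqrt_card {N : ℕ} {S : Finset (Fin N)} {x : EuclideanSpace ℝ (Fin N)}
    (hx : x ∈ supportedOn S) {d : ℝ} (hd : 0 ≤ d) (h : ∀ i, |x i| ≤ d) :
    ‖x‖ ≤ d * √S.card := by
  rw [EuclideanSpace.norm_eq]
  refine Real.sqrt_le_iff.2 ⟨by positivity, ?_⟩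
  rw [mul_pow, Real.sq_sqrt (by positivity)]
  calc ∑ i, ‖x i‖ ^ 2 = ∑ i ∈ S, ‖x i‖ ^ 2 := by
        refine (Finset.sum_subset (Finset.subset_univ S) fun i _ hi => ?_).symm
        simp [hx i hi]
    _ ≤ ∑ _i ∈ S, d ^ 2 := Finset.sum_le_sum fun i _ =>
        pow_le_pow_left₀ (norm_nonneg _) (h i) 2
    _ = d ^ 2 * S.card := by rw [Finset.sum_const, nsmul_eq_mul, mul_comm]

/-- The decreasing rearrangement of the absolute values of the coordinates. -/
lemma exists_decreasing_rearrangement {N : ℕ} (z : Fin N → ℝ) :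
    ∃ t : ℕ → ℝ, Antitone t ∧ (∀ n, 0 ≤ t n) ∧ t N = 0 ∧
      ∑ n ∈ Finset.range N, t n = ∑ i, |z i| ∧
      ∀ n, (Finset.univ.filter fun i => t n < |z i|).card ≤ n := by
  set π := Tuple.sort fun i => -|z i| with hπ
  have hmono : ∀ i j : Fin N, i ≤ j → |z (π j)| ≤ |z (π i)| := fun i j hij => by
    have := Tuple.monotone_sort (fun i => -|z i|) hij
    simpa using this
  refine ⟨fun n => if h : n < N then |z (π ⟨n, h⟩)| else 0, ?_, ?_, ?_, ?_, ?_⟩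
  · intro a b hab
    by_cases hb : b < N
    · simp only [dif_pos hb, dif_pos (hab.trans_lt hb)]
      exact hmono _ _ hab
    · simp only [dif_neg hb]
      split_ifs <;> simp
  · intro n
    dsimp only
    split_ifs <;> simp
  · simp
  · rw [Finset.sum_range, ← Equiv.sum_comp π fun i => |z i|]
    simp
  · intro n
    by_cases hn : n < N
    · simp only [dif_pos hn]
      refine (Finset.card_le_card_of_injOn (t := Finset.range n) (fun i => (π.symm i : ℕ)) ?_
        ?_).trans_eq (Finset.card_range n)
      · intro i hi
        have hi' : |z (π ⟨n, hn⟩)| < |z i| := by simpa using hi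
        rw [Finset.mem_coe, Finset.mem_range]
        by_contra! hle
        have := hmono ⟨n, hn⟩ (π.symm i) hle
        rw [Equiv.apply_symm_apply] at this
        linarith
      · exact fun i _ j _ hij => π.symm.injective (Fin.ext hij)
    · refine (Finset.card_le_univ _).trans ?_
      rw [Fintype.card_fin]
      omega

/-- The soft thresholding function at level `c`. -/
def softThreshold (c x : ℝ) : ℝ := max (x - c) 0 - max (-x - c) 0

lemma softThreshold_zero (x : ℝ) : softThreshold 0 x = x := by
  rw [softThreshold, sub_zero, sub_zero]
  rcases le_total 0 x with h | h
  · rw [max_eq_left h, max_eq_right (by linarith)]; ring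
  · rw [max_eq_right h, max_eq_left (by linarith)]; ring

lemma softThreshold_eq_zero {c x : ℝ} (h : |x| ≤ c) : softThreshold c x = 0 := by
  obtain ⟨h1, h2⟩ := abs_le.1 h
  rw [softThreshold, max_eq_right (by linarith), max_eq_right (by linarith), sub_zero]

lemma softThreshold_neg (c x : ℝ) : softThreshold c (-x) = -softThreshold c x := by
  simp [softThreshold]

lemma softThreshold_of_nonneg {c x : ℝ} (hc : 0 ≤ c) (hx : 0 ≤ x) :
    softThreshold c x = max (x - c) 0 := by
  rw [softThreshold, max_eq_right (by linarith : -x - c ≤ 0), sub_zero]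

lemma abs_softThreshold_le {c c' : ℝ} (hc' : 0 ≤ c') (hcc : c' ≤ c) (x : ℝ) :
    |softThreshold c x| ≤ |softThreshold c' x| := by
  wlog hx : 0 ≤ x generalizing x
  · simpa [softThreshold_neg] using this (-x) (by linarith)
  rw [softThreshold_of_nonneg (hc'.trans hcc) hx, softThreshold_of_nonneg hc' hx,
    abs_of_nonneg (le_max_right _ _), abs_of_nonneg (le_max_right _ _)]
  gcongr

lemma abs_softThreshold_sub_le {c c' : ℝ} (hc' : 0 ≤ c') (hcc : c' ≤ c) (x : ℝ) :
    |softThreshold c' x - softThreshold c x| ≤ c - c' := by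
  wlog hx : 0 ≤ x generalizing x
  · have := this (-x) (by linarith)
    rwa [softThreshold_neg, softThreshold_neg, neg_sub_neg, abs_sub_comm] at this
  rw [softThreshold_of_nonneg (hc'.trans hcc) hx, softThreshold_of_nonneg hc' hx]
  refine (abs_max_sub_max_le_abs _ _ _).trans_eq ?_
  rw [sub_sub_sub_cancel_left, abs_of_nonneg (by linarith)]

/-- The layer cake decomposition of a vector: a chain of soft thresholdings of growing support, whose
increments are flat. -/
lemma exists_layerCake {N : ℕ} (z : EuclideanSpace ℝ (Fin N)) :
    ∃ (h : ℕ → EuclideanSpace ℝ (Fin N)) (d : ℕ → ℝ) (S : ℕ → Finset (Fin N)),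
      (∀ n, 0 ≤ d n) ∧ (∀ n, (S n).card ≤ n) ∧ (∀ n, h n ∈ supportedOn (S n)) ∧
      (∀ n, h n ∈ supportedOn (S (n + 1))) ∧
      (∀ n : ℕ, ‖h (n + 1) - h n‖ ≤ d n * √(n + 1)) ∧ (∀ n, ‖h n‖ ≤ ‖h (n + 1)‖) ∧ h N = z ∧
      ∑ n ∈ Finset.range N, (n + 1) * d n = ∑ i, |z i| := by
  obtain ⟨t, hanti, hpos, hN, hsum, hcard⟩ := exists_decreasing_rearrangement z
  set S : ℕ → Finset (Fin N) := fun n => Finset.univ.filter fun i => t n < |z i| with hS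
  set h : ℕ → EuclideanSpace ℝ (Fin N) := fun n =>
    WithLp.toLp 2 fun i => softThreshold (t n) (z i) with hh
  have hstep : ∀ n, t (n + 1) ≤ t n := fun n => hanti n.le_succ
  have hsupp : ∀ n, h n ∈ supportedOn (S n) := fun n i hi =>
    softThreshold_eq_zero (by simpa [hS] using hi)
  have hsupp' : ∀ n, h n ∈ supportedOn (S (n + 1)) := fun n i hi =>
    softThreshold_eq_zero ((by simpa [hS] using hi : |z i| ≤ t (n + 1)).trans (hstep n))
  have hd : ∀ n, 0 ≤ t n - t (n + 1) := fun n => sub_nonneg.2 (hstep n)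
  refine ⟨h, fun n => t n - t (n + 1), S, hd, hcard, hsupp, hsupp', ?_, ?_, ?_, ?_⟩
  · intro n
    refine (norm_le_mul_sqrt_card (Submodule.sub_mem _ (hsupp (n + 1)) (hsupp' n)) (hd n)
      fun i => abs_softThreshold_sub_le (hpos _) (hstep n) (z i)).trans ?_
    refine mul_le_mul_of_nonneg_left (Real.sqrt_le_sqrt ?_) (hd n)
    exact_mod_cast hcard (n + 1)
  · intro n
    rw [EuclideanSpace.norm_eq, EuclideanSpace.norm_eq]
    refine Real.sqrt_le_sqrt (Finset.sum_le_sum fun i _ => pow_le_pow_left₀ (norm_nonneg _) ?_ 2)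
    exact abs_softThreshold_le (hpos _) (hstep n) (z i)
  · ext i
    simp [hh, hN, softThreshold_zero]
  · have habel : ∀ k : ℕ, ∑ n ∈ Finset.range k, ((n : ℝ) + 1) * (t n - t (n + 1))
        = ∑ n ∈ Finset.range k, t n - k * t k := by
      intro k
      induction k with
      | zero => simp
      | succ k ih =>
        rw [Finset.sum_range_succ, Finset.sum_range_succ, ih]
        push_cast
        ring
    rw [habel, hN, hsum, mul_zero, sub_zero]

lemma sub_le_of_abs_sq_sub_sq_le {a b c : ℝ} (ha : 0 ≤ a) (hc : 0 ≤ c)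
    (h : |a ^ 2 - b ^ 2| ≤ c * b) : b - c ≤ a := by
  by_contra! hlt
  have h1 := (abs_le.1 h).1
  have h2 := mul_le_mul_of_nonneg_left hlt.le ha
  have h3 := mul_lt_mul_of_pos_right (show a < b by linarith) (show 0 < b - c by linarith)
  nlinarith

/-- The multi-level restricted isometry property controls the norms of all vectors in the convex
set cut out by `‖z‖₂ ≤ 1` and `‖z‖₁ ≤ √(2 s)`, up to an additive error. -/
lemma MultiRIP.norm_sub_le_norm_map {N m s : ℕ} {δ : ℝ}
    {P : EuclideanSpace ℝ (Fin N) →ₗ[ℝ] EuclideanSpace ℝ (Fin m)} (hP : MultiRIP s δ P)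
    (hs : 1 ≤ s) (hsN : s ≤ N) (hδ : 0 < δ) (hδ1 : δ ≤ 1) {z : EuclideanSpace ℝ (Fin N)}
    (hz : ‖z‖ ≤ 1) (hz1 : ∑ i, |z i| ≤ √(2 * s)) :
    ‖z‖ - 23 * δ ≤ ‖P z‖ := by
  obtain ⟨h, d, S, hd, hcard, hsupp, hsupp', hinc, hmono, hN, hsum⟩ := exists_layerCake z
  have hs' : (0 : ℝ) < s := by exact_mod_cast hs
  have hss : 0 < √(s : ℝ) := Real.sqrt_pos.2 hs'
  set w : ℕ → ℝ := fun n => (n + 1) * d n / √s with hw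
  have hw0 : ∀ n, 0 ≤ w n := fun n => by have := hd n; positivity
  have hwsum : ∑ n ∈ Finset.range N, w n ≤ 3 / 2 := by
    rw [← Finset.sum_div, hsum, div_le_iff₀ hss]
    refine hz1.trans ?_
    rw [Real.sqrt_mul (by norm_num)]
    gcongr
    exact Real.sqrt_le_iff.2 ⟨by norm_num, by norm_num⟩
  have hmono' : Monotone fun n => ‖h n‖ := monotone_nat_of_le_succ hmono
  set n₁ := min N ⌊(s : ℝ) / δ ^ 2⌋₊ with hn₁
  have hsn₁ : s ≤ n₁ := by
    refine le_min hsN (Nat.le_floor ?_)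
    rw [le_div_iff₀ (by positivity)]
    nlinarith [pow_le_one₀ hδ.le hδ1 (n := 2)]
  have hphase1 : ∀ k, s ≤ k → k ≤ n₁ → |‖P (h k)‖ ^ 2 - ‖h k‖ ^ 2|
      ≤ 4 * δ * ‖h k‖ ^ 2 + 8 * δ * ‖h k‖ * ∑ n ∈ Finset.Ico s k, w n := by
    intro k hsk
    induction k, hsk using Nat.le_induction with
    | base =>
      intro _
      have hη : levelDistortion s δ s ≤ δ := by
        rw [levelDistortion, div_self hs'.ne', Real.sqrt_one]
        exact max_le (by simp) (by nlinarith)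
      have := hP s le_rfl hsN (S s) (hcard s) _ (hsupp s) _ (hsupp s)
      rw [real_inner_self_eq_norm_sq, real_inner_self_eq_norm_sq] at this
      rw [Finset.Ico_self, Finset.sum_empty, mul_zero, add_zero]
      refine this.trans ?_
      rw [mul_assoc, ← sq]
      gcongr
    | succ k hsk ih =>
      intro hk
      have hkN : k + 1 ≤ N := hk.trans (min_le_left _ _)
      have hkf : δ ^ 2 * (((k + 1 : ℕ) : ℝ) / s) ≤ 1 := by
        have h1 : ((k + 1 : ℕ) : ℝ) ≤ s / δ ^ 2 :=
          (Nat.le_floor_iff (by positivity)).1 (hk.trans (min_le_right _ _))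
        rw [le_div_iff₀ (by positivity)] at h1
        rw [mul_div_assoc', div_le_one hs']
        linarith
      have hη : levelDistortion s δ (k + 1) ≤ δ * √(((k + 1 : ℕ) : ℝ) / s) := by
        refine max_le le_rfl ?_
        have h1 : (δ * √(((k + 1 : ℕ) : ℝ) / s)) ^ 2 = δ ^ 2 * (((k + 1 : ℕ) : ℝ) / s) := by
          rw [mul_pow, Real.sq_sqrt (by positivity)]
        have h2 : 0 ≤ δ * √(((k + 1 : ℕ) : ℝ) / s) := by positivity
        rw [← h1] at hkf ⊢
        exact pow_le_of_le_one h2 ((sq_le_one_iff₀ h2).1 hkf) two_ne_zero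
      have hB := hP (k + 1) (by omega) hkN (S (k + 1)) (hcard _) (h (k + 1) - h k)
        (Submodule.sub_mem _ (hsupp _) (hsupp' _)) (h (k + 1) + h k)
        (Submodule.add_mem _ (hsupp _) (hsupp' _))
      have hid : ⟪P (h (k + 1) - h k), P (h (k + 1) + h k)⟫
          - ⟪h (k + 1) - h k, h (k + 1) + h k⟫
          = (‖P (h (k + 1))‖ ^ 2 - ‖h (k + 1)‖ ^ 2) - (‖P (h k)‖ ^ 2 - ‖h k‖ ^ 2) := by
        simp only [map_sub, map_add, inner_sub_left, inner_add_right, real_inner_self_eq_norm_sq,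
          real_inner_comm (P (h (k + 1))) (P (h k)), real_inner_comm (h (k + 1)) (h k)]
        ring
      rw [hid] at hB
      have hsum2 : ‖h (k + 1) + h k‖ ≤ 2 * ‖h (k + 1)‖ :=
        (norm_add_le _ _).trans (by linarith [hmono k])
      have hB2 : 4 * levelDistortion s δ (k + 1) * ‖h (k + 1) - h k‖ * ‖h (k + 1) + h k‖
          ≤ 8 * δ * ‖h (k + 1)‖ * w k := by
        have hdk := hd k
        calc _ ≤ 4 * (δ * √(((k + 1 : ℕ) : ℝ) / s)) * (d k * √(k + 1)) * (2 * ‖h (k + 1)‖) := by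
              gcongr
              exact hinc k
          _ = 8 * δ * ‖h (k + 1)‖ * (d k * (√(k + 1) * √(k + 1)) / √s) := by
              rw [Real.sqrt_div (by positivity)]
              push_cast
              ring
          _ = _ := by
              rw [Real.mul_self_sqrt (by positivity), hw]
              ring
      have ih' := ih (by omega)
      rw [Finset.sum_Ico_succ_top hsk, mul_add]
      have hmk := hmono k
      have hwk : 0 ≤ ∑ n ∈ Finset.Ico s k, w n := Finset.sum_nonneg fun n _ => hw0 n
      have h3 : 4 * δ * ‖h k‖ ^ 2 + 8 * δ * ‖h k‖ * ∑ n ∈ Finset.Ico s k, w n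
          ≤ 4 * δ * ‖h (k + 1)‖ ^ 2 + 8 * δ * ‖h (k + 1)‖ * ∑ n ∈ Finset.Ico s k, w n := by
        gcongr
      have h4 := abs_sub_abs_le_abs_sub (‖P (h (k + 1))‖ ^ 2 - ‖h (k + 1)‖ ^ 2)
        (‖P (h k)‖ ^ 2 - ‖h k‖ ^ 2)
      linarith
  have hphase2 : ∀ n, n₁ ≤ n → n < N →
      ‖h (n + 1) - h n‖ ≤ δ * w n ∧ ‖P (h (n + 1) - h n)‖ ≤ 3 * δ * w n := by
    intro n hn hnN
    have hdn := hd n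
    have hn' : (s : ℝ) / δ ^ 2 ≤ n + 1 := by
      have h1 : ⌊(s : ℝ) / δ ^ 2⌋₊ ≤ n := by
        rcases min_le_iff.1 hn with h | h
        · omega
        · exact h
      exact (Nat.lt_floor_add_one _).le.trans (by exact_mod_cast Nat.succ_le_succ h1)
    have hge : 1 ≤ δ * √((n + 1) / s) := by
      rw [← Real.sqrt_sq hδ.le, ← Real.sqrt_mul (by positivity), Real.one_le_sqrt]
      rw [div_le_iff₀ (by positivity)] at hn'
      rw [mul_div_assoc', one_le_div hs']
      linarith
    have hwn : d n * √(n + 1) * (δ * √((n + 1) / s)) = δ * w n := by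
      rw [Real.sqrt_div (by positivity), hw]
      have : √((n : ℝ) + 1) * √(n + 1) = n + 1 := Real.mul_self_sqrt (by positivity)
      linear_combination (d n * δ / √s) * this
    have hη : levelDistortion s δ (n + 1) ≤ (δ * √((n + 1) / s)) ^ 2 := by
      rw [levelDistortion]
      push_cast
      refine max_le (le_self_pow₀ hge two_ne_zero) ?_
      rw [mul_pow, Real.sq_sqrt (by positivity)]
    set q := δ * √((n + 1) / s) with hq
    have hq0 : 0 ≤ q := by linarith
    have h1 : ‖h (n + 1) - h n‖ ≤ d n * √(n + 1) := hinc n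
    refine ⟨?_, ?_⟩
    · rw [← hwn]
      exact h1.trans (le_mul_of_one_le_right (by positivity) hge)
    · have hmem := Submodule.sub_mem _ (hsupp (n + 1)) (hsupp' n)
      have hB := hP (n + 1) (by omega) hnN (S (n + 1)) (hcard _) _ hmem _ hmem
      rw [real_inner_self_eq_norm_sq, real_inner_self_eq_norm_sq] at hB
      have hB1 := (abs_le.1 hB).2
      set D := ‖h (n + 1) - h n‖ with hD
      have hD0 : 0 ≤ D := norm_nonneg _
      have h2 : 4 * levelDistortion s δ (n + 1) * D * D ≤ 4 * q ^ 2 * D * D := by gcongr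
      have h3 : ‖P (h (n + 1) - h n)‖ ^ 2 ≤ (3 * q * D) ^ 2 := by
        have : D ^ 2 ≤ q ^ 2 * D ^ 2 := le_mul_of_one_le_left (by positivity) (one_le_pow₀ hge)
        nlinarith
      refine (abs_le_of_sq_le_sq' h3 (by positivity)).2.trans ?_
      rw [mul_assoc 3 δ, ← hwn]
      nlinarith [mul_le_mul_of_nonneg_left h1 hq0]
  have hn₁N : n₁ ≤ N := min_le_left _ _
  have htail : z - h n₁ = ∑ n ∈ Finset.Ico n₁ N, (h (n + 1) - h n) := by
    rw [Finset.sum_Ico_sub h hn₁N, hN]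
  have hsub : ∑ n ∈ Finset.Ico n₁ N, w n ≤ 3 / 2 :=
    (Finset.sum_le_sum_of_subset_of_nonneg (fun n hn => Finset.mem_range.2 (Finset.mem_Ico.1 hn).2)
      fun n _ _ => hw0 n).trans hwsum
  have hsub' : ∑ n ∈ Finset.Ico s n₁, w n ≤ 3 / 2 :=
    (Finset.sum_le_sum_of_subset_of_nonneg (fun n hn => Finset.mem_range.2
      ((Finset.mem_Ico.1 hn).2.trans_le hn₁N)) fun n _ _ => hw0 n).trans hwsum
  have ht1 : ‖z - h n₁‖ ≤ 3 / 2 * δ := by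
    rw [htail]
    refine (norm_sum_le_of_le _ fun n hn => (hphase2 n (Finset.mem_Ico.1 hn).1
      (Finset.mem_Ico.1 hn).2).1).trans ?_
    rw [← Finset.mul_sum]
    nlinarith
  have ht2 : ‖P (z - h n₁)‖ ≤ 9 / 2 * δ := by
    rw [htail, map_sum]
    refine (norm_sum_le_of_le _ fun n hn => (hphase2 n (Finset.mem_Ico.1 hn).1
      (Finset.mem_Ico.1 hn).2).2).trans ?_
    rw [← Finset.mul_sum]
    nlinarith
  have hh1 : ‖h n₁‖ ≤ 1 := (hmono' hn₁N).trans (by simpa only [hN] using hz)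
  have hhead : ‖h n₁‖ - 16 * δ ≤ ‖P (h n₁)‖ := by
    refine sub_le_of_abs_sq_sub_sq_le (norm_nonneg _) (by positivity) ((hphase1 n₁ hsn₁ le_rfl).trans ?_)
    have h1 : 8 * δ * ‖h n₁‖ * ∑ n ∈ Finset.Ico s n₁, w n ≤ 8 * δ * ‖h n₁‖ * (3 / 2) := by
      gcongr
    have h2 : 4 * δ * ‖h n₁‖ ^ 2 ≤ 4 * δ * ‖h n₁‖ := by
      have := pow_le_of_le_one (norm_nonneg _) hh1 two_ne_zero
      gcongr
    linarith
  have hz2 : ‖z‖ ≤ ‖h n₁‖ + ‖z - h n₁‖ := by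
    simpa using norm_add_le (h n₁) (z - h n₁)
  have hPz : ‖P (h n₁)‖ ≤ ‖P z‖ + ‖P (z - h n₁)‖ := by
    have := norm_sub_le (P z) (P (z - h n₁))
    rwa [← map_sub, sub_sub_cancel] at this
  linarith

/-- A functional that is dominated, up to `ε`, by `z ↦ ‖P z‖` on a symmetric convex set factors,
up to `ε`, through `P` by a functional of norm at most one. -/
lemma exists_norm_le_one_abs_inner_sub_le {E G : Type*} [NormedAddCommGroup E]
    [InnerProductSpace ℝ E] [NormedAddCommGroup G] [InnerProductSpace ℝ G] [CompleteSpace G]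
    {K : Set E} (hK : Convex ℝ K) (h0 : (0 : E) ∈ K) (hneg : ∀ z ∈ K, -z ∈ K) (P : E →ₗ[ℝ] G)
    (u : E) {ε : ℝ} (hε : 0 < ε) (h : ∀ z ∈ K, ⟪u, z⟫ ≤ ‖P z‖ + ε) :
    ∃ a : G, ‖a‖ ≤ 1 ∧ ∀ z ∈ K, |⟪a, P z⟫ - ⟪u, z⟫| ≤ ε := by
  set A : Set (G × ℝ) := {p | ‖p.1‖ < p.2} with hA
  set B : Set (G × ℝ) := (fun z => (P z, ⟪u, z⟫ - ε)) '' K with hB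
  have hAo : IsOpen A := isOpen_lt (by fun_prop) (by fun_prop)
  have hAc : Convex ℝ A := by
    intro p hp q hq a b ha hb hab
    change ‖a • p.1 + b • q.1‖ < a * p.2 + b * q.2
    have hp' : ‖p.1‖ < p.2 := hp
    have hq' : ‖q.1‖ < q.2 := hq
    refine (norm_add_le _ _).trans_lt ?_
    rw [norm_smul, norm_smul, Real.norm_of_nonneg ha, Real.norm_of_nonneg hb]
    rcases ha.eq_or_lt with rfl | ha'
    · rw [zero_add] at hab
      subst hab
      simpa using hq'
    · exact add_lt_add_of_lt_of_le (mul_lt_mul_of_pos_left hp' ha')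
        (mul_le_mul_of_nonneg_left hq'.le hb)
  have hBc : Convex ℝ B := by
    rintro _ ⟨z, hz, rfl⟩ _ ⟨y, hy, rfl⟩ a b ha hb hab
    refine ⟨a • z + b • y, hK hz hy ha hb hab, ?_⟩
    refine Prod.ext (by simp) ?_
    simp only [inner_add_right, inner_smul_right, Prod.snd_add, Prod.smul_snd, smul_eq_mul]
    linear_combination ε * hab
  have hdisj : Disjoint A B := by
    rw [Set.disjoint_left]
    rintro _ hp ⟨z, hz, rfl⟩
    have h1 : ‖P z‖ < ⟪u, z⟫ - ε := hp
    linarith [h z hz]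
  obtain ⟨f, c, hfA, hfB⟩ := geometric_hahn_banach_open hAc hAo hBc hdisj
  set b := f (0, 1) with hb
  set g : StrongDual ℝ G := f.comp (ContinuousLinearMap.inl ℝ G ℝ) with hg
  have hf : ∀ v r, f (v, r) = g v + r * b := fun v r => by
    have : ((v, r) : G × ℝ) = (v, 0) + r • (0, 1) := by simp
    rw [this, map_add, map_smul]
    rfl
  have hfA' : ∀ v r, ‖v‖ < r → g v + r * b < c := fun v r hvr => by
    rw [← hf]; exact hfA _ hvr
  have hfB' : ∀ z ∈ K, c ≤ g (P z) + (⟪u, z⟫ - ε) * b := fun z hz => by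
    rw [← hf]; exact hfB _ ⟨z, hz, rfl⟩
  have hrb : ∀ r, 0 < r → r * b < c := fun r hr => by
    simpa using hfA' 0 r (by simpa using hr)
  have hc1 : c ≤ -(ε * b) := by simpa using hfB' 0 h0
  have hb0 : b < 0 := by
    have := hrb 1 one_pos
    by_contra! hge
    nlinarith
  have hc0 : 0 ≤ c := by
    by_contra! hlt
    have := hrb (c / b) (div_pos_of_neg_of_neg hlt hb0)
    rw [div_mul_cancel₀ _ hb0.ne] at this
    exact lt_irrefl _ this
  have hcone : ∀ v r, ‖v‖ < r → g v + r * b ≤ 0 := by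
    intro v r hvr
    by_contra! hpos
    have hr := (norm_nonneg v).trans_lt hvr
    obtain ⟨k, hk⟩ := exists_nat_gt (c / (g v + r * b))
    have hk0 : (0 : ℝ) < k := (div_nonneg hc0 hpos.le).trans_lt hk
    have h1 := hfA' ((k : ℝ) • v) (k * r) (by
      rw [norm_smul, Real.norm_of_nonneg hk0.le]
      exact mul_lt_mul_of_pos_left hvr hk0)
    rw [map_smul, smul_eq_mul] at h1
    rw [div_lt_iff₀ hpos] at hk
    linarith
  set a : G := (InnerProductSpace.toDual ℝ G).symm ((-b)⁻¹ • g) with ha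
  have hga : ∀ v, g v = -b * ⟪a, v⟫ := fun v => by
    rw [ha, InnerProductSpace.toDual_symm_apply]
    simp [hb0.ne]
  have hav : ∀ v, ⟪a, v⟫ ≤ ‖v‖ := fun v => by
    refine le_of_forall_gt_imp_ge_of_dense fun r hr => ?_
    have := hcone v r hr
    rw [hga] at this
    nlinarith
  have hlow : ∀ z ∈ K, ⟪u, z⟫ - ε ≤ ⟪a, P z⟫ := fun z hz => by
    have := hfB' z hz
    rw [hga] at this
    nlinarith
  refine ⟨a, ?_, fun z hz => abs_le.2 ⟨by linarith [hlow z hz], ?_⟩⟩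
  · have h1 := hav a
    rw [real_inner_self_eq_norm_sq] at h1
    by_contra! hgt
    nlinarith
  · have := hlow (-z) (hneg z hz)
    rw [map_neg, inner_neg_right, inner_neg_right] at this
    linarith

lemma zero_mem_sparseVecs (N s : ℕ) : (0 : EuclideanSpace ℝ (Fin N)) ∈ sparseVecs N s :=
  ⟨∅, by simp, fun _ _ => rfl⟩

/-- Best `s`-term approximations exist. -/
lemma exists_mem_sparseVecs_forall_norm_sub_le {N : ℕ} (s : ℕ) (y : EuclideanSpace ℝ (Fin N)) :
    ∃ x₀ ∈ sparseVecs N s, ∀ x ∈ sparseVecs N s, ‖y - x₀‖ ≤ ‖y - x‖ := by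
  classical
  obtain ⟨S, hS, hmax⟩ := Finset.exists_max_image
    ((Finset.univ : Finset (Finset (Fin N))).filter fun S => S.card ≤ s)
    (fun S => ∑ i ∈ S, y i ^ 2) ⟨∅, by simp⟩
  have hS' : S.card ≤ s := by simpa using hS
  refine ⟨WithLp.toLp 2 fun i => if i ∈ S then y i else 0, ⟨S, hS', fun i hi => by simp [hi]⟩, ?_⟩
  rintro x ⟨T, hT, hx⟩
  have hTS : ∑ i ∈ T, y i ^ 2 ≤ ∑ i ∈ S, y i ^ 2 := hmax T (by simpa using hT)
  rw [EuclideanSpace.norm_eq, EuclideanSpace.norm_eq]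
  refine Real.sqrt_le_sqrt ?_
  have h1 : ∑ i, ‖(y - WithLp.toLp 2 fun i => if i ∈ S then y i else 0) i‖ ^ 2
      = ∑ i ∈ Sᶜ, y i ^ 2 := by
    rw [← Finset.sum_add_sum_compl S]
    rw [Finset.sum_eq_zero fun i hi => by simp [hi], zero_add]
    exact Finset.sum_congr rfl fun i hi => by simp [Finset.mem_compl.1 hi]
  have h2 : ∑ i ∈ Tᶜ, y i ^ 2 ≤ ∑ i, ‖(y - x) i‖ ^ 2 := by
    calc ∑ i ∈ Tᶜ, y i ^ 2 = ∑ i ∈ Tᶜ, ‖(y - x) i‖ ^ 2 :=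
          Finset.sum_congr rfl fun i hi => by simp [hx i (Finset.mem_compl.1 hi)]
      _ ≤ _ := Finset.sum_le_sum_of_subset_of_nonneg (Finset.subset_univ _)
          fun _ _ _ => by positivity
  have h3 := Finset.sum_add_sum_compl S fun i => y i ^ 2
  have h4 := Finset.sum_add_sum_compl T fun i => y i ^ 2
  linarith

lemma exists_sub_mem_supportedOn {N s : ℕ} {x y : EuclideanSpace ℝ (Fin N)}
    (hx : x ∈ sparseVecs N s) (hy : y ∈ sparseVecs N s) :
    ∃ S : Finset (Fin N), S.card ≤ 2 * s ∧ x - y ∈ supportedOn S := by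
  classical
  obtain ⟨S, hS, hxS⟩ := hx
  obtain ⟨T, hT, hyT⟩ := hy
  refine ⟨S ∪ T, (Finset.card_union_le _ _).trans (by omega), fun i hi => ?_⟩
  rw [Finset.notMem_union] at hi
  simp [hxS i hi.1, hyT i hi.2]

lemma sum_abs_le_sqrt_mul_norm {N k : ℕ} {S : Finset (Fin N)} (hS : S.card ≤ k)
    {x : EuclideanSpace ℝ (Fin N)} (hx : x ∈ supportedOn S) :
    ∑ i, |x i| ≤ √k * ‖x‖ := by
  have h1 : ∑ i, |x i| = ∑ i ∈ S, |x i| :=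
    (Finset.sum_subset (Finset.subset_univ S) fun i _ hi => by simp [hx i hi]).symm
  have h2 : (∑ i ∈ S, |x i|) ^ 2 ≤ S.card * ∑ i ∈ S, |x i| ^ 2 := sq_sum_le_card_mul_sum_sq
  have h3 : ∑ i ∈ S, |x i| ^ 2 ≤ ‖x‖ ^ 2 := by
    rw [EuclideanSpace.norm_sq_eq]
    exact Finset.sum_le_sum_of_subset_of_nonneg (Finset.subset_univ _) fun _ _ _ => by positivity
  rw [h1]
  refine (abs_le_of_sq_le_sq' ?_ (by positivity)).2
  rw [mul_pow, Real.sq_sqrt (by positivity)]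
  refine h2.trans ?_
  gcongr

/-- The symmetric convex set `{‖z‖₂ ≤ 1, ‖z‖₁ ≤ √(2 s)}`. -/
def sparseHull (N s : ℕ) : Set (EuclideanSpace ℝ (Fin N)) :=
  {z | ‖z‖ ≤ 1 ∧ ∑ i, |z i| ≤ √(2 * s)}

lemma convex_sparseHull (N s : ℕ) : Convex ℝ (sparseHull N s) := by
  rintro x ⟨hx1, hx2⟩ y ⟨hy1, hy2⟩ a b ha hb hab
  have hcomb : ∀ {p q r : ℝ}, p ≤ r → q ≤ r → a * p + b * q ≤ r := fun {p q r} hp hq => by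
    calc a * p + b * q ≤ a * r + b * r := by gcongr
      _ = r := by rw [← add_mul, hab, one_mul]
  constructor
  · refine (norm_add_le _ _).trans ?_
    rw [norm_smul, norm_smul, Real.norm_of_nonneg ha, Real.norm_of_nonneg hb]
    exact hcomb hx1 hy1
  · refine le_trans ?_ (hcomb hx2 hy2)
    rw [Finset.mul_sum, Finset.mul_sum, ← Finset.sum_add_distrib]
    refine Finset.sum_le_sum fun i _ => ?_
    change |a * x i + b * y i| ≤ _
    refine (abs_add_le _ _).trans_eq ?_
    rw [abs_mul, abs_mul, abs_of_nonneg ha, abs_of_nonneg hb]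

lemma neg_mem_sparseHull {N s : ℕ} {z : EuclideanSpace ℝ (Fin N)} (hz : z ∈ sparseHull N s) :
    -z ∈ sparseHull N s := by
  refine ⟨by simpa using hz.1, by simpa using hz.2⟩

lemma inv_norm_smul_mem_sparseHull {N s : ℕ} {S : Finset (Fin N)} (hS : S.card ≤ 2 * s)
    {x : EuclideanSpace ℝ (Fin N)} (hx : x ∈ supportedOn S) :
    ‖x‖⁻¹ • x ∈ sparseHull N s := by
  have h1 : ‖‖x‖⁻¹ • x‖ ≤ 1 := by
    rw [norm_smul, norm_inv, norm_norm]
    exact inv_mul_le_one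
  refine ⟨h1, (sum_abs_le_sqrt_mul_norm hS (Submodule.smul_mem _ _ hx)).trans ?_⟩
  push_cast
  exact mul_le_of_le_one_right (by positivity) h1

lemma MultiRIP.abs_norm_map_sq_sub_le {N m s : ℕ} {δ : ℝ}
    {P : EuclideanSpace ℝ (Fin N) →ₗ[ℝ] EuclideanSpace ℝ (Fin m)} (hP : MultiRIP s δ P)
    (hs : 1 ≤ s) (hsN : s ≤ N) (hδ : 0 < δ) (hδ1 : δ ≤ 1) {S : Finset (Fin N)}
    (hS : S.card ≤ 2 * s) {x : EuclideanSpace ℝ (Fin N)} (hx : x ∈ supportedOn S) :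
    |‖P x‖ ^ 2 - ‖x‖ ^ 2| ≤ 8 * δ * ‖x‖ ^ 2 := by
  have hs' : (0 : ℝ) < s := by exact_mod_cast hs
  have hSN : S.card ≤ N := by simpa using Finset.card_le_univ S
  have hB := hP (min (2 * s) N) (le_min (by omega) hsN) (min_le_right _ _) S (le_min hS hSN)
    x hx x hx
  have hle : ((min (2 * s) N : ℕ) : ℝ) / s ≤ 2 := by
    rw [div_le_iff₀ hs']
    exact_mod_cast min_le_left _ _
  have hη : levelDistortion s δ (min (2 * s) N) ≤ 2 * δ := by
    refine max_le ?_ ?_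
    · have : √(((min (2 * s) N : ℕ) : ℝ) / s) ≤ 2 := Real.sqrt_le_iff.2 ⟨by norm_num, by linarith⟩
      nlinarith
    · have h1 : δ ^ 2 ≤ δ := pow_le_of_le_one hδ.le hδ1 two_ne_zero
      calc _ ≤ δ * 2 := by gcongr
        _ = _ := by ring
  rw [real_inner_self_eq_norm_sq, real_inner_self_eq_norm_sq] at hB
  refine hB.trans ?_
  calc _ ≤ 4 * (2 * δ) * ‖x‖ * ‖x‖ := by gcongr
    _ = _ := by ring

/-- The image of a single additional point under the terminal extension of `P`. -/
lemma MultiRIP.exists_extension {N m s : ℕ} {δ : ℝ}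
    {P : EuclideanSpace ℝ (Fin N) →ₗ[ℝ] EuclideanSpace ℝ (Fin m)} (hP : MultiRIP s δ P)
    (hs : 1 ≤ s) (hsN : s ≤ N) (hδ : 0 < δ) (hδ1 : δ ≤ 1) (y : EuclideanSpace ℝ (Fin N)) :
    ∃ p : EuclideanSpace ℝ (Fin m) × ℝ, (y ∈ sparseVecs N s → p = (P y, 0)) ∧
      ∀ x ∈ sparseVecs N s,
        |‖p.1 - P x‖ ^ 2 + p.2 ^ 2 - ‖x - y‖ ^ 2| ≤ 124 * δ * ‖x - y‖ ^ 2 := by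
  by_cases hy : y ∈ sparseVecs N s
  · refine ⟨(P y, 0), fun _ => rfl, fun x hx => ?_⟩
    obtain ⟨S, hS, hxy⟩ := exists_sub_mem_supportedOn hx hy
    have h1 := hP.abs_norm_map_sq_sub_le hs hsN hδ hδ1 hS hxy
    have h2 : ‖P y - P x‖ = ‖P (x - y)‖ := by rw [norm_sub_rev, map_sub]
    simp only [h2]
    rw [zero_pow two_ne_zero, add_zero]
    refine h1.trans ?_
    gcongr
    norm_num
  · obtain ⟨x₀, hx₀, hmin⟩ := exists_mem_sparseVecs_forall_norm_sub_le s y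
    have hρ : 0 < ‖y - x₀‖ := norm_pos_iff.2 (sub_ne_zero.2 fun h => hy (h ▸ hx₀))
    set ρ := ‖y - x₀‖ with hρdef
    set u := ρ⁻¹ • (y - x₀) with hu
    have hu1 : ‖u‖ = 1 := by
      rw [hu, norm_smul, norm_inv, Real.norm_of_nonneg hρ.le, ← hρdef, inv_mul_cancel₀ hρ.ne']
    obtain ⟨a, ha1, ha⟩ := exists_norm_le_one_abs_inner_sub_le (convex_sparseHull N s)
      (by simp [sparseHull]) (fun z hz => neg_mem_sparseHull hz) P u
      (ε := 23 * δ) (by positivity) (fun z hz => by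
        have h1 := hP.norm_sub_le_norm_map hs hsN hδ hδ1 hz.1 hz.2
        have h2 := real_inner_le_norm u z
        rw [hu1, one_mul] at h2
        linarith)
    have hr : 0 ≤ ρ ^ 2 - ‖ρ • a‖ ^ 2 := by
      rw [norm_smul, Real.norm_of_nonneg hρ.le, mul_pow]
      nlinarith [pow_le_one₀ (norm_nonneg a) ha1 (n := 2), sq_nonneg ρ]
    refine ⟨(P x₀ + ρ • a, √(ρ ^ 2 - ‖ρ • a‖ ^ 2)), fun h => absurd h hy, fun x hx => ?_⟩
    obtain ⟨S, hS, hxS⟩ := exists_sub_mem_supportedOn hx hx₀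
    set v := x - x₀ with hv
    set D := ‖x - y‖ with hD
    have hρD : ρ ≤ D := by rw [hD, norm_sub_rev]; exact hmin x hx
    have hvD : ‖v‖ ≤ 2 * D := by
      have h1 : v = (x - y) + (y - x₀) := by rw [hv]; abel
      rw [h1]
      refine (norm_add_le _ _).trans ?_
      linarith
    have hcross : |⟪ρ • a, P v⟫ - ⟪y - x₀, v⟫| ≤ 23 * δ * ρ * ‖v‖ := by
      have h1 := ha _ (inv_norm_smul_mem_sparseHull hS hxS)
      by_cases hv0 : v = 0
      · simp [hv0]
      have hvn : 0 < ‖v‖ := norm_pos_iff.2 hv0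
      have h2 : ⟪ρ • a, P v⟫ - ⟪y - x₀, v⟫
          = ρ * ‖v‖ * (⟪a, P (‖v‖⁻¹ • v)⟫ - ⟪u, ‖v‖⁻¹ • v⟫) := by
        rw [hu, map_smul]
        simp only [inner_smul_right, real_inner_smul_left]
        field_simp
      rw [h2, abs_mul, abs_of_pos (by positivity)]
      calc _ ≤ ρ * ‖v‖ * (23 * δ) := by gcongr
        _ = _ := by ring
    have hRIP := hP.abs_norm_map_sq_sub_le hs hsN hδ hδ1 hS hxS
    have hexp : ‖P x₀ + ρ • a - P x‖ ^ 2 = ‖P v‖ ^ 2 - 2 * ⟪ρ • a, P v⟫ + ‖ρ • a‖ ^ 2 := by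
      have : P x₀ + ρ • a - P x = ρ • a - P v := by rw [hv, map_sub]; abel
      rw [this, norm_sub_sq_real]
      ring
    have hexp2 : D ^ 2 = ‖v‖ ^ 2 - 2 * ⟪y - x₀, v⟫ + ρ ^ 2 := by
      have : x - y = v - (y - x₀) := by rw [hv]; abel
      rw [hD, this, norm_sub_sq_real, real_inner_comm]
    simp only
    rw [hexp, Real.sq_sqrt hr, hexp2]
    have hD0 : 0 ≤ D := norm_nonneg _
    have hb1 : 8 * δ * ‖v‖ ^ 2 ≤ 8 * δ * (2 * D) ^ 2 := by gcongr
    have hb2 : 23 * δ * ρ * ‖v‖ ≤ 23 * δ * D * (2 * D) := by gcongr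
    rw [← hexp2]
    rw [abs_le] at hcross hRIP ⊢
    constructor <;> linarith

/-- Append an additional first coordinate. -/
def consCoord {m : ℕ} (p : EuclideanSpace ℝ (Fin m) × ℝ) : EuclideanSpace ℝ (Fin (m + 1)) :=
  WithLp.toLp 2 (Fin.cons p.2 p.1 : Fin (m + 1) → ℝ)

lemma norm_consCoord_sub_sq {m : ℕ} (p q : EuclideanSpace ℝ (Fin m) × ℝ) :
    ‖consCoord p - consCoord q‖ ^ 2 = ‖p.1 - q.1‖ ^ 2 + (p.2 - q.2) ^ 2 := by
  rw [EuclideanSpace.norm_sq_eq, EuclideanSpace.norm_sq_eq, Fin.sum_univ_succ]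
  simp [consCoord, add_comm]

lemma bounds_of_abs_sq_sub_sq_le {a b ε : ℝ} (ha : 0 ≤ a) (hb : 0 ≤ b) (hε : 0 ≤ ε)
    (h : |a ^ 2 - b ^ 2| ≤ ε * b ^ 2) : (1 - ε) * b ≤ a ∧ a ≤ (1 + ε) * b := by
  constructor
  · have := sub_le_of_abs_sq_sub_sq_le ha (mul_nonneg hε hb) (h.trans_eq (by ring))
    linarith
  · refine (abs_le_of_sq_le_sq' ?_ (by positivity)).2
    nlinarith [(abs_le.1 h).2, mul_nonneg hε (sq_nonneg b), mul_nonneg (sq_nonneg ε) (sq_nonneg b)]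

lemma sInf_image_bounds {α : Type*} {A : Set α} (hA : A.Nonempty) {g h : α → ℝ} {ε : ℝ}
    (hε : 0 ≤ ε) (hε1 : ε ≤ 1) (hg : ∀ x ∈ A, 0 ≤ g x) (hh : ∀ x ∈ A, 0 ≤ h x)
    (hl : ∀ x ∈ A, (1 - ε) * g x ≤ h x) (hu : ∀ x ∈ A, h x ≤ (1 + ε) * g x) :
    (1 - ε) * sInf (g '' A) ≤ sInf (h '' A) ∧ sInf (h '' A) ≤ (1 + ε) * sInf (g '' A) := by
  have hgb : BddBelow (g '' A) := ⟨0, by rintro _ ⟨x, hx, rfl⟩; exact hg x hx⟩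
  have hhb : BddBelow (h '' A) := ⟨0, by rintro _ ⟨x, hx, rfl⟩; exact hh x hx⟩
  constructor
  · refine le_csInf (hA.image h) ?_
    rintro _ ⟨x, hx, rfl⟩
    refine le_trans ?_ (hl x hx)
    exact mul_le_mul_of_nonneg_left (csInf_le hgb ⟨x, hx, rfl⟩) (by linarith)
  · rw [← div_le_iff₀' (by positivity)]
    refine le_csInf (hA.image g) ?_
    rintro _ ⟨x, hx, rfl⟩
    rw [div_le_iff₀' (by positivity)]
    exact (csInf_le hhb ⟨x, hx, rfl⟩).trans (hu x hx)

theorem stmt_15 :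
    ∃ C : ℝ, 0 < C ∧ ∀ N s : ℕ, 1 ≤ s → s < N →
      ∀ ε : ℝ, ε ∈ Set.Ioo (0 : ℝ) 1 →
      ∃ m : ℕ, (m : ℝ) ≤ C * ε⁻¹ ^ 2 * s * Real.log (Real.exp 1 * N / s) ∧
      ∃ f : EuclideanSpace ℝ (Fin N) → EuclideanSpace ℝ (Fin m),
        (∀ x ∈ sparseVecs N s, ∀ y : EuclideanSpace ℝ (Fin N),
          (1 - ε) * ‖x - y‖ ≤ ‖f x - f y‖ ∧ ‖f x - f y‖ ≤ (1 + ε) * ‖x - y‖) ∧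
        ∀ z : EuclideanSpace ℝ (Fin N),
          (1 - ε) * sInf ((fun y => ‖z - y‖) '' sparseVecs N s) ≤
              sInf ((fun t => ‖f z - f t‖) '' sparseVecs N s) ∧
            sInf ((fun t => ‖f z - f t‖) '' sparseVecs N s) ≤
              (1 + ε) * sInf ((fun y => ‖z - y‖) '' sparseVecs N s) := by
  refine ⟨9218 * 124 ^ 2, by norm_num, fun N s hs hsN ε hε => ?_⟩
  obtain ⟨hε0, hε1⟩ := hε
  have hs' : (1 : ℝ) ≤ s := by exact_mod_cast hs
  have hsN' : (s : ℝ) ≤ N := by exact_mod_cast hsN.le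
  set δ := ε / 124 with hδdef
  have hδ : 0 < δ := by positivity
  have hδ1 : δ ≤ 1 := by rw [hδdef]; linarith
  set L := Real.log (Real.exp 1 * N / s) with hL
  have hL1 : 1 ≤ L := by
    rw [hL, Real.le_log_iff_exp_le (div_pos (mul_pos (Real.exp_pos 1) (by linarith)) (by linarith)),
      le_div_iff₀ (by linarith)]
    gcongr
  set T := δ⁻¹ ^ 2 * s * L with hT
  have hT1 : 1 ≤ T := one_le_mul_of_one_le_of_one_le
    (one_le_mul_of_one_le_of_one_le (one_le_pow₀ ((one_le_inv₀ hδ).2 hδ1)) hs') hL1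
  have hTε : T = 124 ^ 2 * (ε⁻¹ ^ 2 * s * L) := by
    rw [hT, hδdef, inv_div]; ring
  obtain ⟨P, hP⟩ := exists_multiRIP (m := ⌈9216 * T⌉₊) hs hsN.le hδ (Nat.le_ceil _)
  refine ⟨⌈9216 * T⌉₊ + 1, ?_, ?_⟩
  · have h1 := Nat.ceil_lt_add_one (show 0 ≤ 9216 * T by linarith)
    push_cast
    linarith
  choose p hp1 hp2 using hP.exists_extension hs hsN.le hδ hδ1
  have hmain : ∀ x ∈ sparseVecs N s, ∀ y : EuclideanSpace ℝ (Fin N),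
      (1 - ε) * ‖x - y‖ ≤ ‖consCoord (p x) - consCoord (p y)‖ ∧
        ‖consCoord (p x) - consCoord (p y)‖ ≤ (1 + ε) * ‖x - y‖ := by
    intro x hx y
    refine bounds_of_abs_sq_sub_sq_le (norm_nonneg _) (norm_nonneg _) hε0.le ?_
    rw [norm_sub_rev (consCoord (p x)), norm_consCoord_sub_sq, hp1 x hx, sub_zero]
    refine (hp2 y x hx).trans_eq ?_
    rw [hδdef]; ring
  refine ⟨fun y => consCoord (p y), hmain, fun z => ?_⟩
  refine sInf_image_bounds ⟨0, zero_mem_sparseVecs N s⟩ hε0.le hε1.le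
    (fun _ _ => norm_nonneg _) (fun _ _ => norm_nonneg _) (fun x hx => ?_) fun x hx => ?_
  · rw [norm_sub_rev z, norm_sub_rev (consCoord (p z))]
    exact (hmain x hx z).1
  · rw [norm_sub_rev z, norm_sub_rev (consCoord (p z))]
    exact (hmain x hx z).2
end
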